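/- arXiv:1208.6220 — 2 statements merged into one kernel-verified Lean document; each statement's English description precedes it below -/
import Mathlib

section
/- The only rational points on the genus-two hyperelliptic curve y^2 = x(x - 1)(x^3 - 2x^2 + x - 1) with y = 0 or otherwise are the affine points (0,0) and (1,0); i.e., there are no rational points (x,y) with y ≠ 0. -/
open Polynomial NumberField

namespace Plastic

noncomputable def pol : ℚ[X] := X ^ 3 - X - 1

lemma pol_monic : pol.Monic := by unfold pol; monicity!
lemma pol_natDegree : pol.natDegree = 3 := by unfold pol; compute_degree!

lemma pol_irr : Irreducible pol := by
  have hz : (X ^ 3 - X - 1 : ℤ[X]).Monic := by monicity!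
  have hmap : (X ^ 3 - X - 1 : ℤ[X]).map (algebraMap ℤ ℚ) = pol := by simp [pol]
  rw [Polynomial.irreducible_iff_roots_eq_zero_of_degree_le_three
    (by rw [pol_natDegree]; norm_num) (by rw [pol_natDegree])]
  rw [Multiset.eq_zero_iff_forall_notMem]
  intro a ha
  have ha' : aeval a (X ^ 3 - X - 1 : ℤ[X]) = 0 := by
    have := (mem_roots'.1 ha).2
    rw [IsRoot.def, ← hmap, eval_map_algebraMap] at this
    exact this
  obtain ⟨n, hn, -⟩ := exists_integer_of_is_root_of_monic hz ha'
  subst hn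
  have h1 : n ^ 3 - n - 1 = 0 := by
    have : ((n ^ 3 - n - 1 : ℤ) : ℚ) = 0 := by simpa using ha'
    exact_mod_cast this
  have h2 : n * (n ^ 2 - 1) = 1 := by linarith
  rcases Int.eq_one_or_neg_one_of_mul_eq_one h2 with h | h <;> subst h <;> norm_num at h2

instance : Fact (Irreducible pol) := ⟨pol_irr⟩

abbrev K := AdjoinRoot pol

instance : FiniteDimensional ℚ K := (AdjoinRoot.powerBasis pol_irr.ne_zero).finite
instance : NumberField K where

noncomputable def r : K := AdjoinRoot.root pol

lemma r_cube : r ^ 3 = r + 1 := by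
  have h := AdjoinRoot.eval₂_root pol
  have h2 : eval₂ (AdjoinRoot.of pol) (AdjoinRoot.root pol) (X ^ 3 - X - 1) = 0 := h
  simp only [eval₂_sub, eval₂_X_pow, eval₂_X, eval₂_one] at h2
  unfold r
  linear_combination h2

noncomputable def B : Module.Basis (Fin 3) ℚ K :=
  (AdjoinRoot.powerBasis pol_irr.ne_zero).basis.reindex
    (finCongr (by simp [pol_natDegree]))

lemma B_apply (i : Fin 3) : B i = r ^ (i : ℕ) := by
  rw [B, Module.Basis.reindex_apply, PowerBasis.basis_eq_pow]
  simp [r]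

lemma finrank_K : Module.finrank ℚ K = 3 := by
  rw [Module.finrank_eq_card_basis B]; simp

lemma trace_aux (z : K) (M : Fin 3 → Fin 3 → ℚ)
    (h : ∀ i : Fin 3, z * r ^ (i : ℕ) = M i 0 • 1 + M i 1 • r + M i 2 • r ^ 2) :
    Algebra.trace ℚ K z = M 0 0 + M 1 1 + M 2 2 := by
  have h' : ∀ i : Fin 3, z * B i = M i 0 • B 0 + M i 1 • B 1 + M i 2 • B 2 := by
    intro i; simp only [B_apply]; rw [h]; simp
  rw [Algebra.trace_eq_matrix_trace B, Matrix.trace_fin_three]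
  simp only [Algebra.leftMulMatrix_eq_repr_mul, h']
  simp

lemma tr0 : Algebra.trace ℚ K (1 : K) = 3 := by
  rw [trace_aux 1 ![![1,0,0],![0,1,0],![0,0,1]]]
  · simp; norm_num
  · intro i; fin_cases i <;> simp
lemma tr1 : Algebra.trace ℚ K r = 0 := by
  rw [trace_aux r ![![0,1,0],![0,0,1],![1,1,0]]]
  · simp
  · intro i; fin_cases i <;> simp
    · ring
    · linear_combination r_cube
lemma tr2 : Algebra.trace ℚ K (r ^ 2) = 2 := by
  rw [trace_aux (r^2) ![![0,0,1],![1,1,0],![0,1,1]]]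
  · simp; norm_num
  · intro i; fin_cases i <;> simp
    · linear_combination r_cube
    · linear_combination r * r_cube
lemma tr3 : Algebra.trace ℚ K (r ^ 3) = 3 := by
  rw [r_cube, map_add, tr0, tr1]; norm_num
lemma tr4 : Algebra.trace ℚ K (r ^ 4) = 2 := by
  rw [show r ^ 4 = r ^ 2 + r by linear_combination r * r_cube, map_add, tr2, tr1]; norm_num

lemma r_int : IsIntegral ℤ r := by
  refine ⟨X ^ 3 - X - 1, by monicity!, ?_⟩
  simp; linear_combination r_cube

noncomputable def ρ : 𝓞 K := ⟨r, r_int⟩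

lemma ρ_coe : (algebraMap (𝓞 K) K) ρ = r := rfl

lemma ρ_cube : ρ ^ 3 = ρ + 1 := by
  apply RingOfIntegers.ext
  simp only [map_pow, map_add, map_one, ρ_coe]; exact r_cube

noncomputable def vv : Fin 3 → 𝓞 K := fun i => ρ ^ (i : ℕ)

lemma trZ (n : ℕ) (k : ℤ) (h : Algebra.trace ℚ K (r ^ n) = k) :
    Algebra.trace ℤ (𝓞 K) (ρ ^ n) = k := by
  have := Algebra.coe_trace_int (K := K) (ρ ^ n)
  have h2 : ((ρ ^ n : 𝓞 K) : K) = r ^ n := by simp [ρ_coe]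
  rw [h2, h] at this
  exact_mod_cast this

lemma discr_vv : Algebra.discr ℤ vv = -23 := by
  have t0 := trZ 0 3 (by simpa using tr0)
  have t1 := trZ 1 0 (by simpa using tr1)
  have t2 := trZ 2 2 (by simpa using tr2)
  have t3 := trZ 3 3 (by simpa using tr3)
  have t4 := trZ 4 2 (by simpa using tr4)
  rw [Algebra.discr_def, Matrix.det_fin_three]
  simp only [Algebra.traceMatrix_apply, Algebra.traceForm_apply, vv, ← pow_add]
  norm_num at *
  simp [*]

noncomputable def b0 : Module.Basis (Fin 3) ℤ (𝓞 K) :=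
  (RingOfIntegers.basis K).reindex (Fintype.equivOfCardEq (by
    rw [← Module.finrank_eq_card_chooseBasisIndex, RingOfIntegers.rank, finrank_K]; simp))

lemma det_sq : (b0.toMatrix vv).det ^ 2 * NumberField.discr K = -23 := by
  have h := Algebra.discr_of_matrix_vecMul (A := ℤ) b0 (b0.toMatrix vv)
  rw [Module.Basis.toMatrix_map_vecMul, discr_vv, NumberField.discr_eq_discr] at h
  exact h.symm

lemma det_sq1 : (b0.toMatrix vv).det ^ 2 = 1 := by
  have h := det_sq
  set d := (b0.toMatrix vv).det
  have h1 : d ^ 2 ∣ 23 := ⟨-NumberField.discr K, by linarith⟩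
  have h2 : |d| ≤ 4 := by
    have := Int.le_of_dvd (by norm_num) h1
    by_contra! hh
    nlinarith [sq_abs d]
  have h3 := abs_le.1 h2
  obtain ⟨h3, h4⟩ := h3
  interval_cases d <;> omega

lemma discrK : NumberField.discr K = -23 := by
  have h := det_sq
  rw [det_sq1] at h; linarith

lemma det_unit : IsUnit (b0.det vv) := by
  rw [Module.Basis.det_apply]
  exact IsUnit.of_mul_eq_one _ (by rw [← sq]; exact det_sq1)

lemma span_vv (z : 𝓞 K) : ∃ a b c : ℤ, z = a + b * ρ + c * ρ ^ 2 := by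
  have h := ((Module.Basis.is_basis_iff_det b0).2 det_unit).2
  have hz : z ∈ Submodule.span ℤ (Set.range vv) := by rw [h]; trivial
  rw [Submodule.mem_span_range_iff_exists_fun] at hz
  obtain ⟨c, hc⟩ := hz
  refine ⟨c 0, c 1, c 2, ?_⟩
  rw [← hc, Fin.sum_univ_three]
  simp [vv]

lemma indep_vv (a b c : ℤ) (h0 : (a : 𝓞 K) + b * ρ + c * ρ ^ 2 = 0) : a = 0 ∧ b = 0 ∧ c = 0 := by
  have h := ((Module.Basis.is_basis_iff_det b0).2 det_unit).1
  rw [Fintype.linearIndependent_iff] at h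
  have := h ![a, b, c] (by rw [Fin.sum_univ_three]; simpa [vv] using h0)
  exact ⟨this 0, this 1, this 2⟩

lemma nrC : InfinitePlace.nrComplexPlaces K = 1 := by
  have h := NumberField.sign_discr (K := K)
  rw [discrK] at h
  have h2 := InfinitePlace.card_add_two_mul_card_eq_rank K
  rw [finrank_K] at h2
  have : InfinitePlace.nrComplexPlaces K ≤ 1 := by omega
  interval_cases h3 : InfinitePlace.nrComplexPlaces K
  · exact absurd h (by decide)
  · rfl

instance pid : IsPrincipalIdealRing (𝓞 K) := by
  apply RingOfIntegers.isPrincipalIdealRing_of_abs_discr_lt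
  rw [discrK, finrank_K, nrC]
  have : (3:ℝ) < Real.pi := Real.pi_gt_three
  norm_num [Nat.factorial]
  nlinarith

lemma unit_rank : Units.rank K = 1 := by
  unfold Units.rank
  rw [InfinitePlace.card_eq_nrRealPlaces_add_nrComplexPlaces, nrC]
  have h2 := InfinitePlace.card_add_two_mul_card_eq_rank K
  rw [finrank_K, nrC] at h2
  omega

lemma unit_form : ∃ ε : (𝓞 K)ˣ, ∀ u : (𝓞 K)ˣ, ∃ n : ℤ, u = ε ^ n ∨ u = - ε ^ n := by
  have h1 : 0 < Units.rank K := by rw [unit_rank]; norm_num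
  refine ⟨Units.fundSystem K ⟨0, h1⟩, fun u => ?_⟩
  obtain ⟨⟨ζ, e⟩, h, -⟩ := Units.exist_unique_eq_mul_prod K u
  have : Subsingleton (Fin (Units.rank K)) := by rw [unit_rank]; infer_instance
  refine ⟨e ⟨0, h1⟩, ?_⟩
  rw [Fintype.prod_subsingleton _ (⟨0, h1⟩ : Fin (Units.rank K))] at h
  simp only at h
  rcases Units.torsion_eq_one_or_neg_one_of_odd_finrank (by rw [finrank_K]; decide) ζ with h3 | h3
  · left; rw [h, h3, one_mul]
  · right; rw [h, h3]; simp


/-- The properties of `ℤ[ρ]`, `ρ³ = ρ + 1`, used in the descents. -/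
structure PR {R : Type} [CommRing R] (ρ : R) : Prop where
  cube : ρ ^ 3 = ρ + 1
  span : ∀ z : R, ∃ a b c : ℤ, z = a + b * ρ + c * ρ ^ 2
  indep : ∀ a b c : ℤ, (a : R) + b * ρ + c * ρ ^ 2 = 0 → a = 0 ∧ b = 0 ∧ c = 0

section coords
variable {R : Type} [CommRing R] {ρ : R}

lemma PR.ext (h : PR ρ) {a b c a' b' c' : ℤ}
    (e : (a : R) + b * ρ + c * ρ ^ 2 = a' + b' * ρ + c' * ρ ^ 2) : a = a' ∧ b = b' ∧ c = c' := by
  have := h.indep (a - a') (b - b') (c - c') (by push_cast; linear_combination e)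
  omega

lemma PR.ne_sq (h : PR ρ) (x : R) : x ^ 2 ≠ ρ ∧ x ^ 2 ≠ -ρ := by
  obtain ⟨a, b, c, rfl⟩ := h.span x
  have key : ∀ k : ℤ, k = 1 ∨ k = -1 → ((a : R) + b * ρ + c * ρ ^ 2) ^ 2 ≠ k * ρ := by
    intro k hk e
    have e2 : ((a ^ 2 + 2 * b * c : ℤ) : R) + ((2 * a * b + 2 * b * c + c ^ 2 : ℤ) : R) * ρ
        + ((b ^ 2 + 2 * a * c + c ^ 2 : ℤ) : R) * ρ ^ 2
        = ((0 : ℤ) : R) + (k : ℤ) * ρ + ((0 : ℤ) : R) * ρ ^ 2 := by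
      push_cast
      linear_combination e - (2 * b * c + c ^ 2 * ρ) * h.cube
    obtain ⟨h1, h2, h3⟩ := h.ext e2
    have ha : Even a := by
      have : Even (a ^ 2) := ⟨-(b * c), by linarith⟩
      exact (Int.even_pow.1 this).1
    obtain ⟨a', rfl⟩ := ha
    have hbc : Even (b * c) := ⟨-(a' ^ 2), by nlinarith⟩
    have hc : Odd c := by
      by_contra hc
      rw [Int.not_odd_iff_even] at hc
      obtain ⟨c', rfl⟩ := hc
      rcases hk with rfl | rfl
      · have : 2 * ((a' + a') * b + b * (c' + c') + 2 * c' ^ 2) = 1 := by linarith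
        omega
      · have : 2 * ((a' + a') * b + b * (c' + c') + 2 * c' ^ 2) = -1 := by linarith
        omega
    have hb : Even b := by
      rcases Int.even_mul.1 hbc with hb | hb
      · exact hb
      · exact absurd hc (by rwa [Int.not_odd_iff_even])
    obtain ⟨b', rfl⟩ := hb
    obtain ⟨c', rfl⟩ := hc
    have : 2 * (2 * b' ^ 2 + (a' + a') * (2 * c' + 1) + 2 * c' ^ 2 + 2 * c') = -1 := by linarith
    omega
  constructor
  · simpa using key 1 (Or.inl rfl)
  · simpa using key (-1) (Or.inr rfl)

/-- the list of representatives of units modulo squares -/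
def Kap (ρ κ : R) : Prop := κ = 1 ∨ κ = -1 ∨ κ = ρ ∨ κ = -ρ

end coords

lemma prK : PR ρ := ⟨ρ_cube, span_vv, indep_vv⟩

lemma units_form (u : 𝓞 K) (hu : IsUnit u) : ∃ κ v : 𝓞 K, Kap ρ κ ∧ IsUnit v ∧ u = κ * v ^ 2 := by
  obtain ⟨ε, hε⟩ := unit_form
  have hρ : IsUnit ρ := IsUnit.of_mul_eq_one (ρ ^ 2 - 1) (by linear_combination ρ_cube)
  obtain ⟨rr, hrr⟩ := hρ
  obtain ⟨n, hn⟩ := hε rr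
  have hodd : Odd n := by
    by_contra hne
    rw [Int.not_odd_iff_even] at hne
    obtain ⟨k, rfl⟩ := hne
    have h1 := prK.ne_sq ((ε ^ k : (𝓞 K)ˣ) : 𝓞 K)
    rw [← hrr] at h1
    rcases hn with hn | hn
    · exact h1.1 (by rw [hn, zpow_add]; push_cast; ring)
    · exact h1.2 (by rw [hn, zpow_add]; push_cast; ring)
  obtain ⟨w, rfl⟩ := hu
  obtain ⟨m, hm⟩ := hε w
  rcases Int.even_or_odd m with ⟨k, rfl⟩ | hmo
  · rcases hm with hm | hm
    · exact ⟨1, (ε ^ k : (𝓞 K)ˣ), by simp [Kap], Units.isUnit _, by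
        rw [hm, zpow_add]; push_cast; ring⟩
    · exact ⟨-1, (ε ^ k : (𝓞 K)ˣ), by simp [Kap], Units.isUnit _, by
        rw [hm, zpow_add]; push_cast; ring⟩
  · obtain ⟨k, hk⟩ := hmo.sub_odd hodd
    have hmk : m = n + (k + k) := by linarith
    have e1 : ε ^ m = ε ^ n * (ε ^ k * ε ^ k) := by rw [hmk, zpow_add, zpow_add]
    have e2 : ((ε ^ m : (𝓞 K)ˣ) : 𝓞 K) = ρ * ((ε ^ k : (𝓞 K)ˣ) : 𝓞 K) ^ 2 ∨
        ((ε ^ m : (𝓞 K)ˣ) : 𝓞 K) = -ρ * ((ε ^ k : (𝓞 K)ˣ) : 𝓞 K) ^ 2 := by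
      rcases hn with hn | hn
      · left; rw [← hrr, hn, e1]; push_cast; ring
      · right; rw [← hrr, hn, e1]; push_cast; ring
    rcases hm with hm | hm <;> rcases e2 with e2 | e2
    · exact ⟨ρ, _, by simp [Kap], Units.isUnit (ε ^ k), by rw [hm, e2]⟩
    · exact ⟨-ρ, _, by simp [Kap], Units.isUnit (ε ^ k), by rw [hm, e2]⟩
    · exact ⟨-ρ, _, by simp [Kap], Units.isUnit (ε ^ k), by
        rw [hm, Units.val_neg, e2]; ring⟩
    · exact ⟨ρ, _, by simp [Kap], Units.isUnit (ε ^ k), by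
        rw [hm, Units.val_neg, e2]; ring⟩

/-- coordinates of an element in the basis `1, ρ, ρ²` -/
noncomputable def co (z : 𝓞 K) : ℤ × ℤ × ℤ :=
  ((span_vv z).choose, (span_vv z).choose_spec.choose, (span_vv z).choose_spec.choose_spec.choose)

lemma co_spec (z : 𝓞 K) : z = (co z).1 + (co z).2.1 * ρ + (co z).2.2 * ρ ^ 2 :=
  (span_vv z).choose_spec.choose_spec.choose_spec

lemma co_eq {z : 𝓞 K} {a b c : ℤ} (e : z = a + b * ρ + c * ρ ^ 2) : co z = (a, b, c) := by
  have h := co_spec z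
  rw [e] at h
  obtain ⟨h1, h2, h3⟩ := prK.ext h
  rw [← e] at h1 h2 h3
  ext <;> simp [← h1, ← h2, ← h3]

abbrev Q := ZMod 4 × ZMod 4 × ZMod 4

/-- multiplication in `(ℤ/4)[ρ]` -/
def mQ (u v : Q) : Q :=
  (u.1 * v.1 + u.2.1 * v.2.2 + u.2.2 * v.2.1,
   u.1 * v.2.1 + u.2.1 * v.1 + (u.2.1 * v.2.2 + u.2.2 * v.2.1) + u.2.2 * v.2.2,
   u.1 * v.2.2 + u.2.1 * v.2.1 + u.2.2 * v.1 + u.2.2 * v.2.2)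

def evQ (u : Q) : Prop := 2 * u.1 = 0 ∧ 2 * u.2.1 = 0 ∧ 2 * u.2.2 = 0

instance (u : Q) : Decidable (evQ u) := by unfold evQ; infer_instance

/-- reduction modulo 4 -/
noncomputable def red (z : 𝓞 K) : Q := ((co z).1, (co z).2.1, (co z).2.2)

lemma red_eq {z : 𝓞 K} {a b c : ℤ} (e : z = a + b * ρ + c * ρ ^ 2) : red z = (↑a, ↑b, ↑c) := by
  simp [red, co_eq e]

lemma red_mul (x y : 𝓞 K) : red (x * y) = mQ (red x) (red y) := by
  have hx := co_spec x
  have hy := co_spec y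
  generalize co x = u at hx
  generalize co y = v at hy
  obtain ⟨a, b, c⟩ := u
  obtain ⟨d, e, f⟩ := v
  simp only at hx hy
  have : x * y = ((a * d + b * f + c * e : ℤ) : 𝓞 K)
      + ((a * e + b * d + (b * f + c * e) + c * f : ℤ) : 𝓞 K) * ρ
      + ((a * f + b * e + c * d + c * f : ℤ) : 𝓞 K) * ρ ^ 2 := by
    rw [hx, hy]; push_cast
    linear_combination (b * f + c * e + c * f * ρ) * ρ_cube
  rw [red_eq this, red_eq hx, red_eq hy]
  simp [mQ]

lemma red_add (x y : 𝓞 K) : red (x + y) = red x + red y := by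
  have : x + y = (((co x).1 + (co y).1 : ℤ) : 𝓞 K) + (((co x).2.1 + (co y).2.1 : ℤ) : 𝓞 K) * ρ
      + (((co x).2.2 + (co y).2.2 : ℤ) : 𝓞 K) * ρ ^ 2 := by
    push_cast
    linear_combination co_spec x + co_spec y
  rw [red_eq this]; simp [red]

lemma red_neg (x : 𝓞 K) : red (-x) = -red x := by
  have : -x = ((-(co x).1 : ℤ) : 𝓞 K) + ((-(co x).2.1 : ℤ) : 𝓞 K) * ρ
      + ((-(co x).2.2 : ℤ) : 𝓞 K) * ρ ^ 2 := by
    push_cast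
    linear_combination - co_spec x
  rw [red_eq this]; simp [red]

lemma red_sub (x y : 𝓞 K) : red (x - y) = red x - red y := by
  rw [sub_eq_add_neg, red_add, red_neg, sub_eq_add_neg]

lemma red_int (n : ℤ) : red (n : 𝓞 K) = ((n : ZMod 4), 0, 0) := by
  rw [red_eq (a := n) (b := 0) (c := 0) (by simp)]; simp

lemma red_one : red 1 = (1, 0, 0) := by
  have := red_int 1
  simpa using this

lemma red_ρ : red ρ = (0, 1, 0) := by
  rw [red_eq (a := 0) (b := 1) (c := 0) (by simp)]; simp

lemma red_two : red 2 = (2, 0, 0) := by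
  have := red_int 2
  simpa using this

lemma even_iff (z : 𝓞 K) : 2 ∣ z ↔ evQ (red z) := by
  constructor
  · rintro ⟨w, rfl⟩
    rw [red_mul, red_two]
    generalize red w = u
    revert u; decide +kernel
  · intro h
    have hz := co_spec z
    unfold red at h
    generalize co z = u at hz h
    obtain ⟨a, b, c⟩ := u
    have key : ∀ n : ℤ, 2 * (n : ZMod 4) = 0 → ∃ k, n = 2 * k := by
      intro n hn
      have : ((2 * n : ℤ) : ZMod 4) = 0 := by push_cast; exact hn
      rw [ZMod.intCast_zmod_eq_zero_iff_dvd] at this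
      exact ⟨n / 2, by push_cast at this; omega⟩
    obtain ⟨a, rfl⟩ := key _ h.1
    obtain ⟨b, rfl⟩ := key _ h.2.1
    obtain ⟨c, rfl⟩ := key _ h.2.2
    exact ⟨a + b * ρ + c * ρ ^ 2, by rw [hz]; push_cast; ring⟩

lemma two_prime (x y : 𝓞 K) (h : 2 ∣ x * y) : 2 ∣ x ∨ 2 ∣ y := by
  simp only [even_iff, red_mul] at *
  revert h
  generalize red x = u
  generalize red y = v
  revert u v
  decide +kernel

lemma two_sq (x : 𝓞 K) (h : 2 ∣ x ^ 2) : 2 ∣ x := by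
  rw [sq] at h
  exact (two_prime _ _ h).elim id id

lemma one_odd : ¬ (2 : 𝓞 K) ∣ 1 := by
  rw [even_iff, red_one]; decide

lemma unit_odd {x : 𝓞 K} (h : IsUnit x) : ¬ (2 : 𝓞 K) ∣ x := fun h2 =>
  one_odd (h2.trans h.dvd)

lemma two_int (n : ℤ) : (2 : 𝓞 K) ∣ n ↔ 2 ∣ n := by
  constructor
  · intro h
    obtain ⟨w, hw⟩ := h
    have hc := co_spec w
    have : (n : 𝓞 K) = ((2 * (co w).1 : ℤ) : 𝓞 K) + ((2 * (co w).2.1 : ℤ) : 𝓞 K) * ρ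
      + ((2 * (co w).2.2 : ℤ) : 𝓞 K) * ρ ^ 2 := by
      push_cast
      linear_combination hw + 2 * hc
    have h1 := co_eq this
    have h2 := co_eq (z := (n : 𝓞 K)) (a := n) (b := 0) (c := 0) (by simp)
    rw [h2] at h1
    exact ⟨(co w).1, (Prod.ext_iff.1 h1).1⟩
  · rintro ⟨k, rfl⟩
    exact ⟨k, by push_cast; ring⟩

/-- the odd squares modulo 4 -/
def TT : List Q := [(0, 0, 1), (0, 1, 1), (1, 0, 0), (1, 1, 3), (1, 2, 1), (2, 3, 2), (3, 1, 0)]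

lemma mem_TT {x : 𝓞 K} (h : ¬ 2 ∣ x) : red (x ^ 2) ∈ TT := by
  rw [even_iff] at h
  rw [sq, red_mul]
  revert h
  generalize red x = u
  revert u
  decide +kernel

/-- the classes of `1, -1, ρ, -ρ` modulo 4 -/
def KK : List Q := [(1, 0, 0), (3, 0, 0), (0, 1, 0), (0, 3, 0)]

lemma mem_KK {x : 𝓞 K} (h : Kap ρ x) : red x ∈ KK := by
  rcases h with rfl | rfl | rfl | rfl
  · rw [red_one]; decide
  · rw [red_neg, red_one]; decide
  · rw [red_ρ]; decide
  · rw [red_neg, red_ρ]; decide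

lemma KK_inj {x y : 𝓞 K} (hx : Kap ρ x) (hy : Kap ρ y) (h : red x = red y) : x = y := by
  rcases hx with rfl | rfl | rfl | rfl <;> rcases hy with rfl | rfl | rfl | rfl <;>
    first | rfl | (exfalso; simp only [red_neg, red_one, red_ρ] at h; revert h; decide)

/-- all squares modulo 4 -/
def TA : List Q := (0, 0, 0) :: TT

lemma mem_TA (x : 𝓞 K) : red (x ^ 2) ∈ TA := by
  rw [sq, red_mul]
  generalize red x = u
  revert u
  decide +kernel

lemma evQ_sq {x : 𝓞 K} : 2 ∣ x ↔ red (x ^ 2) = 0 := by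
  rw [even_iff, sq, red_mul]
  generalize red x = u
  revert u
  decide +kernel

lemma check1 : ∀ k ∈ KK, ∀ k' ∈ KK, ∀ e ∈ KK, ∀ s2 ∈ TT, ∀ s3 ∈ TT, ∀ s0 ∈ TA,
    mQ k s2 - mQ k' s3 = mQ e s0 → ∀ s1 ∈ TT,
    mQ (0, 1, 0) (mQ (0, 0, 1) (mQ k s2) - mQ k' s3) = mQ e (mQ k (mQ k' s1)) →
    s0 = 0 ∧ k' = k ∧ e = k := by
  decide +kernel

lemma ρ_unit : IsUnit ρ := IsUnit.of_mul_eq_one (ρ ^ 2 - 1) (by linear_combination ρ_cube)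

lemma Kap.unit {κ : 𝓞 K} (h : Kap ρ κ) : IsUnit κ := by
  rcases h with rfl | rfl | rfl | rfl
  · exact isUnit_one
  · exact isUnit_one.neg
  · exact ρ_unit
  · exact ρ_unit.neg

lemma fac1 {X Y t u : 𝓞 K} (hu : IsUnit u) (hc : IsCoprime X Y) (h : X * Y = u * t ^ 2) :
    ∃ κ α : 𝓞 K, Kap ρ κ ∧ X = κ * α ^ 2 := by
  obtain ⟨v, hv⟩ := hu.exists_right_inv
  have hvu : IsUnit v := IsUnit.of_mul_eq_one u (by linear_combination hv)
  have hc' : IsCoprime X (Y * v) := (isCoprime_mul_unit_right_right hvu X Y).2 hc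
  obtain ⟨d, w, hd⟩ := exists_associated_pow_of_mul_eq_pow' (k := 2) (c := t) hc'
    (by linear_combination v * h + t ^ 2 * hv)
  obtain ⟨κ, a, hk, -, hw⟩ := units_form w w.isUnit
  exact ⟨κ, d * a, hk, by rw [← hd, hw]; ring⟩

lemma sq_dvd_sq {a b : 𝓞 K} (h : a ^ 2 ∣ b ^ 2) : a ∣ b :=
  (IsIntegrallyClosed.pow_dvd_pow_iff two_ne_zero).1 h

lemma fac2 {X Y E : 𝓞 K} (hc : IsCoprime X Y) (hE : E ≠ 0) (h : X * Y = ρ * E ^ 2) :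
    ∃ κ r s : 𝓞 K, Kap ρ κ ∧ X = κ * r ^ 2 ∧ E = r * s ∧ κ * Y = ρ * s ^ 2 := by
  obtain ⟨κ, r, hk, rfl⟩ := fac1 ρ_unit hc h
  have : r ^ 2 ∣ E ^ 2 := by
    rw [← ρ_unit.dvd_mul_left (a := r ^ 2)]
    rw [← h]
    exact ⟨κ * Y, by ring⟩
  obtain ⟨s, rfl⟩ := sq_dvd_sq this
  refine ⟨κ, r, s, hk, rfl, rfl, ?_⟩
  have hr : r ^ 2 ≠ 0 := pow_ne_zero 2 (left_ne_zero_of_mul hE)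
  apply mul_left_cancel₀ hr
  linear_combination h

lemma halves {A B w : 𝓞 K} (h : A ^ 2 - B ^ 2 = 4 * w) (hA : ¬ 2 ∣ A) (hc : IsCoprime A w) :
    ∃ X Y : 𝓞 K, A = X + Y ∧ X * Y = w ∧ ¬ 2 ∣ X ∧ IsCoprime X Y := by
  have key : ∀ X Y : 𝓞 K, A = X + Y → X * Y = w → IsCoprime X Y := by
    rintro X Y rfl rfl
    have h1 : IsCoprime (Y + X) X := by rw [add_comm]; exact hc.of_mul_right_left
    exact (IsCoprime.of_add_mul_left_left (z := 1) (by simpa using h1)).symm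
  have h2 : 2 ∣ A + B := by
    have : 2 ∣ (A + B) * (A - B) := ⟨2 * w, by linear_combination h⟩
    rcases two_prime _ _ this with h | ⟨k, hk⟩
    · exact h
    · exact ⟨k + B, by linear_combination hk⟩
  obtain ⟨X, hX⟩ := h2
  have h4 : (4 : 𝓞 K) ≠ 0 := by norm_num
  have hXY : X * (A - X) = w := by
    apply mul_left_cancel₀ h4
    have hB : B = 2 * X - A := by linear_combination hX
    rw [hB] at h
    linear_combination h
  by_cases h2 : 2 ∣ X
  · refine ⟨A - X, X, by ring, by linear_combination hXY, ?_, key _ _ (by ring) (by linear_combination hXY)⟩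
    intro h3
    exact hA (by simpa using dvd_add h3 h2)
  · exact ⟨X, A - X, by ring, hXY, h2, key _ _ (by ring) hXY⟩

def Sol (A B C D : 𝓞 K) : Prop :=
  A ^ 2 - B ^ 2 = ρ * D ^ 2 ∧ A ^ 2 - C ^ 2 = ρ ^ 3 * D ^ 2 ∧ IsCoprime A D ∧ 2 ∣ D ∧ D ≠ 0

lemma final_check {κ κ' ε g0 g1 g2 g3 : 𝓞 K} (hk : Kap ρ κ) (hk' : Kap ρ κ') (he : Kap ρ ε)
    (h1 : ¬ 2 ∣ g1) (h2 : ¬ 2 ∣ g2) (h3 : ¬ 2 ∣ g3)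
    (e1 : κ * g2 ^ 2 - κ' * g3 ^ 2 = ε * g0 ^ 2)
    (e2 : ρ * (ρ ^ 2 * (κ * g2 ^ 2) - κ' * g3 ^ 2) = ε * (κ * (κ' * g1 ^ 2))) :
    2 ∣ g0 ∧ κ' = κ ∧ ε = κ := by
  have e1' := congrArg red e1
  have e2' := congrArg red e2
  have hρ2 : red (ρ ^ 2) = (0, 0, 1) := by rw [sq, red_mul, red_ρ]; decide
  rw [red_sub, red_mul, red_mul, red_mul] at e1'
  rw [red_mul, red_sub, red_mul, red_mul κ, red_mul κ', red_mul ε, red_mul κ, red_mul κ', red_ρ, hρ2]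
    at e2'
  obtain ⟨c1, c2, c3⟩ := check1 _ (mem_KK hk) _ (mem_KK hk') _ (mem_KK he) _ (mem_TT h2) _ (mem_TT h3)
    _ (mem_TA g0) e1' _ (mem_TT h1) e2'
  exact ⟨evQ_sq.2 c1, KK_inj hk' hk c2, KK_inj he hk c3⟩

lemma descent_step {A B C D : 𝓞 K} (h : Sol A B C D) :
    ∃ A' B' C' D' : 𝓞 K, Sol A' B' C' D' ∧ 2 * D' ∣ D := by
  obtain ⟨hB, hC, hco, ⟨E, rfl⟩, hD⟩ := h
  have hE : E ≠ 0 := right_ne_zero_of_mul hD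
  have hA2 : ¬ 2 ∣ A := fun hA => by
    have := hco.isUnit_of_dvd' hA (dvd_mul_right 2 E)
    exact unit_odd this dvd_rfl
  have hAE : IsCoprime A E := hco.of_mul_right_right
  have hAρ : ∀ n : ℕ, IsCoprime A (ρ ^ n * E ^ 2) := fun n =>
    (isCoprime_mul_unit_left_right (ρ_unit.pow n) _ _).2 hAE.pow_right
  obtain ⟨X, Y, hA, hXY, hX2, hXc⟩ := halves (B := B) (w := ρ ^ 1 * E ^ 2) (by linear_combination hB) hA2 (hAρ 1)
  obtain ⟨X', Y', hA', hXY', hX2', hXc'⟩ :=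
    halves (B := C) (w := ρ ^ 3 * E ^ 2) (by linear_combination hC) hA2 (hAρ 3)
  obtain ⟨κ, r, s, hk, rfl, rfl, hs⟩ := fac2 hXc hE (by linear_combination hXY)
  obtain ⟨κ', r', s', hk', rfl, hrs', hs'⟩ := fac2 (E := ρ * (r * s)) hXc' (mul_ne_zero ρ_unit.ne_zero hE)
    (by linear_combination hXY')
  have hrs : IsCoprime r s := by
    have h1 : IsCoprime (κ * r ^ 2) (κ * Y) := (isCoprime_mul_unit_left_right hk.unit _ _).2 hXc
    rw [hs, isCoprime_mul_unit_left_right ρ_unit, isCoprime_mul_unit_left_left hk.unit] at h1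
    exact (IsCoprime.pow_iff two_pos two_pos).1 h1
  have hdv : r ∣ r' * s' := ⟨ρ * s, by linear_combination -hrs'⟩
  obtain ⟨g1, g2, ⟨g3, rfl⟩, ⟨t, rfl⟩, rfl⟩ := exists_dvd_and_dvd_of_dvd_mul hdv
  obtain ⟨g0, rfl⟩ : ∃ g0, t = ρ * g0 := ⟨(ρ ^ 2 - 1) * t, by linear_combination -t * ρ_cube⟩
  have hr0 : g1 * g2 ≠ 0 := left_ne_zero_of_mul hE
  have hs0 : s = g3 * g0 := by
    apply mul_left_cancel₀ (mul_ne_zero ρ_unit.ne_zero hr0)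
    linear_combination hrs'
  subst hs0
  have hg0 : g0 ≠ 0 := right_ne_zero_of_mul (right_ne_zero_of_mul hE)
  have hg01 : IsCoprime g0 g1 := hrs.of_mul_left_left.of_mul_right_right.symm
  have hg23 : IsCoprime g2 g3 := hrs.of_mul_left_right.of_mul_right_left
  have main : κ * κ' * g1 ^ 2 * (κ * g2 ^ 2 - κ' * g3 ^ 2)
      = ρ * g0 ^ 2 * (κ * ρ ^ 2 * g2 ^ 2 - κ' * g3 ^ 2) := by
    linear_combination κ * κ' * (hA' - hA) - κ' * hs + κ * hs'
  have hg : IsCoprime (g0 ^ 2) (κ * κ' * g1 ^ 2) :=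
    (isCoprime_mul_unit_left_right (hk.unit.mul hk'.unit) _ _).2 hg01.pow
  obtain ⟨e, he⟩ : g0 ^ 2 ∣ κ * g2 ^ 2 - κ' * g3 ^ 2 :=
    hg.dvd_of_dvd_mul_left ⟨ρ * (κ * ρ ^ 2 * g2 ^ 2 - κ' * g3 ^ 2), by linear_combination main⟩
  have he2 : κ * κ' * e * g1 ^ 2 = ρ * (κ * ρ ^ 2 * g2 ^ 2 - κ' * g3 ^ 2) := by
    apply mul_left_cancel₀ (pow_ne_zero 2 hg0)
    linear_combination main - κ * κ' * g1 ^ 2 * he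
  have heu : IsUnit e := by
    have d2 : e ∣ g2 ^ 2 := by
      rw [← hk.unit.dvd_mul_left]
      refine ⟨κ * κ' * g1 ^ 2 - ρ * g0 ^ 2, ?_⟩
      linear_combination -he2 - ρ * he - κ * g2 ^ 2 * ρ_cube
    have d3 : e ∣ g3 ^ 2 := by
      rw [← hk'.unit.dvd_mul_left]
      refine ⟨κ * κ' * g1 ^ 2 - ρ ^ 3 * g0 ^ 2, ?_⟩
      linear_combination -he2 - ρ ^ 3 * he - κ' * g3 ^ 2 * ρ_cube
    exact hg23.pow.isUnit_of_dvd' d2 d3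
  obtain ⟨ε, η, hε, hη, rfl⟩ := units_form e heu
  have o1 : ¬ 2 ∣ η * g1 := by
    intro h
    rcases two_prime _ _ h with h | h
    · exact unit_odd hη h
    · exact hX2 (Dvd.dvd.mul_left (dvd_pow (Dvd.dvd.mul_right h g2) two_ne_zero) _)
  have o2 : ¬ 2 ∣ g2 := fun h =>
    hX2 (Dvd.dvd.mul_left (dvd_pow (Dvd.dvd.mul_left h g1) two_ne_zero) _)
  have o3 : ¬ 2 ∣ g3 := fun h =>
    hX2' (Dvd.dvd.mul_left (dvd_pow (Dvd.dvd.mul_left h g1) two_ne_zero) _)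
  obtain ⟨f1, f2, f3⟩ := final_check (g0 := η * g0) hk hk' hε o1 o2 o3
    (by linear_combination he) (by linear_combination -he2)
  subst f2
  subst f3
  have q1 : g2 ^ 2 - g3 ^ 2 = (η * g0) ^ 2 := by
    apply mul_left_cancel₀ hk.unit.ne_zero
    linear_combination he
  have q2 : ρ ^ 3 * g2 ^ 2 - ρ * g3 ^ 2 = (ε * (η * g1)) ^ 2 := by
    apply mul_left_cancel₀ hk.unit.ne_zero
    linear_combination -he2
  refine ⟨ε * (η * g1), g2, g3, η * g0, ⟨?_, ?_, ?_, f1, mul_ne_zero hη.ne_zero hg0⟩, ?_⟩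
  · linear_combination -q2 + ρ * q1 + g2 ^ 2 * ρ_cube
  · linear_combination -q2 + ρ ^ 3 * q1 + g3 ^ 2 * ρ_cube
  · rw [isCoprime_mul_unit_left_left hk.unit, isCoprime_mul_unit_left_left hη,
      isCoprime_mul_unit_left_right hη]
    exact hg01.symm
  · apply mul_dvd_mul_left
    have : η * g0 ∣ g0 := hη.mul_left_dvd.2 dvd_rfl
    exact this.trans ⟨g1 * g2 * g3, by ring⟩

lemma no_sol {A B C D : 𝓞 K} : ¬ Sol A B C D := by
  induction D using (WellFounded.induction (wellFounded_dvdNotUnit (α := 𝓞 K)))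
    generalizing A B C with
  | _ D ih =>
    intro h
    obtain ⟨A', B', C', D', h', t, ht⟩ := descent_step h
    refine ih D' ⟨h'.2.2.2.2, 2 * t, ?_, by rw [ht]; ring⟩ h'
    intro hu
    exact unit_odd hu (dvd_mul_right _ _)

/-- the norm form -/
def Nf (a b c : ℤ) : ℤ :=
  a * ((a + c) ^ 2 - b * (b + c)) - c * (b * (a + c) - c * (b + c)) + b * (b * b - c * (a + c))

noncomputable def nm (z : 𝓞 K) : ℤ := Nf (co z).1 (co z).2.1 (co z).2.2

lemma nm_eq {z : 𝓞 K} {a b c : ℤ} (e : z = a + b * ρ + c * ρ ^ 2) : nm z = Nf a b c := by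
  simp [nm, co_eq e]

lemma nm_mul (x y : 𝓞 K) : nm (x * y) = nm x * nm y := by
  obtain ⟨a, b, c, hx⟩ := span_vv x
  obtain ⟨d, e, f, hy⟩ := span_vv y
  have : x * y = ((a * d + b * f + c * e : ℤ) : 𝓞 K)
      + ((a * e + b * d + (b * f + c * e) + c * f : ℤ) : 𝓞 K) * ρ
      + ((a * f + b * e + c * d + c * f : ℤ) : 𝓞 K) * ρ ^ 2 := by
    rw [hx, hy]; push_cast
    linear_combination (b * f + c * e + c * f * ρ) * ρ_cube
  rw [nm_eq hx, nm_eq hy, nm_eq this]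
  unfold Nf
  ring

lemma nm_unit {z : 𝓞 K} (h : nm z ^ 2 = 1) : IsUnit z := by
  obtain ⟨a, b, c, hz⟩ := span_vv z
  have h1 : z * ((((a + c) ^ 2 - b * (b + c) : ℤ) : 𝓞 K) + ((-(b * (a + c) - c * (b + c)) : ℤ) : 𝓞 K) * ρ
    + ((b * b - c * (a + c) : ℤ) : 𝓞 K) * ρ ^ 2) = (nm z : ℤ) := by
    rw [nm_eq hz, Nf, hz]
    push_cast
    linear_combination ((b : 𝓞 K) * (b * b - c * (a + c)) + c * (-(b * (a + c) - c * (b + c)))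
      + c * (b * b - c * (a + c)) * ρ) * ρ_cube
  have h2 : IsUnit ((nm z : ℤ) : 𝓞 K) := by
    apply IsUnit.of_mul_eq_one ((nm z : ℤ) : 𝓞 K)
    rw [← sq]; exact_mod_cast h
  rw [← h1] at h2
  exact isUnit_of_mul_isUnit_left h2

lemma nm_one : nm 1 = 1 := by
  rw [nm_eq (a := 1) (b := 0) (c := 0) (by simp)]; decide

lemma nm_kap {κ : 𝓞 K} (h : Kap ρ κ) : nm κ ^ 2 = 1 := by
  rcases h with rfl | rfl | rfl | rfl
  · rw [nm_one]; rfl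
  · rw [nm_eq (a := -1) (b := 0) (c := 0) (by simp)]; decide
  · rw [nm_eq (a := 0) (b := 1) (c := 0) (by simp)]; decide
  · rw [nm_eq (a := 0) (b := -1) (c := 0) (by simp)]; decide

lemma nm_irr {π : 𝓞 K} (h : nm π ^ 2 = 23 ^ 2) : Irreducible π := by
  have h' : (nm π).natAbs = 23 := by
    exact Int.natAbs_eq_iff_sq_eq.2 h
  constructor
  · intro hu
    obtain ⟨v, hv⟩ := hu.exists_right_inv
    have h1 := congrArg nm hv
    rw [nm_mul, nm_one] at h1
    have := congrArg Int.natAbs h1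
    rw [Int.natAbs_mul, h'] at this
    simp at this
  · intro a b hab
    have h1 : (nm a).natAbs * (nm b).natAbs = 23 := by
      rw [← Int.natAbs_mul, ← nm_mul, ← hab, h']
    have hp : Nat.Prime 23 := by norm_num
    have key : ∀ w : 𝓞 K, (nm w).natAbs = 1 → IsUnit w := by
      intro w hw
      apply nm_unit
      rw [← Int.natAbs_sq, hw]; rfl
    rw [← h1, Nat.prime_mul_iff] at hp
    rcases hp with hp | hp
    · exact Or.inr (key _ hp.2)
    · exact Or.inl (key _ hp.2)

lemma sq23 {r n : ℤ} (hr : r ≠ 0) (h : r ^ 2 = 23 * n ^ 2) : False := by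
  have hn : n ≠ 0 := by
    rintro rfl
    exact hr (by simpa using h)
  obtain ⟨k, rfl⟩ : n ∣ r := (Int.pow_dvd_pow_iff two_ne_zero).1 ⟨23, by rw [h]; ring⟩
  have hk : k ^ 2 = 23 := by
    apply mul_left_cancel₀ (pow_ne_zero 2 hn)
    linear_combination h
  have h1 : k < 5 := by nlinarith
  have h2 : -5 < k := by nlinarith
  interval_cases k <;> omega

lemma unit_sq_aux {z H π w q : 𝓞 K} {r ε : ℤ} (hε : ε = 1 ∨ ε = -1) (hr : r ≠ 0)
    (hzH : z * H = (ε : 𝓞 K) * (r : 𝓞 K) ^ 2) (hq : IsCoprime z q) (hw : H = q ^ 2 * π + z * w)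
    (hπ : nm π ^ 2 = 23 ^ 2) (hz : nm z = ε * r ^ 2) :
    ∃ κ α : 𝓞 K, Kap ρ κ ∧ z = κ * α ^ 2 := by
  have hεu : IsUnit (ε : 𝓞 K) := by rcases hε with rfl | rfl <;> simp
  rcases (nm_irr hπ).isCoprime_or_dvd z with hc | ⟨X, rfl⟩
  · have : IsCoprime z H := by
      rw [hw]
      exact IsCoprime.add_mul_left_right (hq.pow_right.mul_right hc.symm) w
    exact fac1 hεu this hzH
  · exfalso
    have hπ0 : π ≠ 0 := (nm_irr hπ).ne_zero
    have hXY : IsCoprime X (q ^ 2 + X * w) :=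
      IsCoprime.add_mul_left_right hq.of_mul_left_right.pow_right w
    have hd : π ^ 2 ∣ (r : 𝓞 K) ^ 2 := by
      rw [← hεu.dvd_mul_left (a := π ^ 2), ← hzH]
      exact ⟨X * (q ^ 2 + X * w), by rw [hw]; ring⟩
    obtain ⟨s, hs⟩ := sq_dvd_sq hd
    obtain ⟨κ, α, hk, rfl⟩ := fac1 (t := s) hεu hXY (by
      apply mul_left_cancel₀ (pow_ne_zero 2 hπ0)
      rw [hs, hw] at hzH
      linear_combination hzH)
    rw [nm_mul, nm_mul, sq α, nm_mul] at hz
    have h1 := congrArg (· ^ 2) hz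
    simp only [mul_pow] at h1
    rw [hπ, nm_kap hk] at h1
    have hε2 : ε ^ 2 = 1 := by rcases hε with rfl | rfl <;> rfl
    rw [hε2] at h1
    have h2 : r ^ 2 = 23 * nm α ^ 2 := by
      apply (pow_left_inj₀ (sq_nonneg r) (by positivity) two_ne_zero).1
      linear_combination -h1
    exact sq23 hr h2

lemma unit_sq {ψ : 𝓞 K} {b p q r ε : ℤ} (hψ : ψ ^ 3 - 2 * ψ ^ 2 + b * ψ - 1 = 0)
    (hπ : nm (3 * ψ ^ 2 - 4 * ψ + b) ^ 2 = 23 ^ 2)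
    (hε : ε = 1 ∨ ε = -1) (hr : r ≠ 0) (hpq : IsCoprime p q)
    (hF : p ^ 3 - 2 * p ^ 2 * q + b * p * q ^ 2 - q ^ 3 = ε * r ^ 2)
    (hN : nm (p - q * ψ) = p ^ 3 - 2 * p ^ 2 * q + b * p * q ^ 2 - q ^ 3) :
    ∃ κ α : 𝓞 K, Kap ρ κ ∧ (p : 𝓞 K) - q * ψ = κ * α ^ 2 := by
  have hF' : (p : 𝓞 K) ^ 3 - 2 * p ^ 2 * q + b * p * q ^ 2 - q ^ 3 = ε * r ^ 2 := by exact_mod_cast hF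
  refine unit_sq_aux (H := p ^ 2 + (ψ - 2) * p * q + (ψ ^ 2 - 2 * ψ + b) * q ^ 2)
    (w := p + (2 * ψ - 2) * q) (q := q) hε hr ?_ ?_ ?_ hπ (hN.trans hF)
  · linear_combination hF' - (q : 𝓞 K) ^ 3 * hψ
  · have h1 : IsCoprime (p : 𝓞 K) q := by
      have := hpq.map (Int.castRingHom (𝓞 K))
      simpa using this
    have := IsCoprime.add_mul_left_left h1 (-ψ)
    convert this using 1; ring
  · ring

lemma unit_sq1 {p q r ε : ℤ} (hε : ε = 1 ∨ ε = -1) (hr : r ≠ 0) (hpq : IsCoprime p q)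
    (hF : p ^ 3 - 2 * p ^ 2 * q + p * q ^ 2 - q ^ 3 = ε * r ^ 2) :
    ∃ κ α : 𝓞 K, Kap ρ κ ∧ (p : 𝓞 K) - q * ρ ^ 2 = κ * α ^ 2 := by
  refine unit_sq (b := 1) ?_ ?_ hε hr hpq (by linear_combination hF) ?_
  · push_cast; linear_combination (ρ ^ 3 - ρ + 1) * ρ_cube
  · rw [nm_eq (a := 1) (b := 3) (c := -1) (by push_cast; linear_combination 3 * ρ * ρ_cube)]
    decide
  · rw [nm_eq (a := p) (b := 0) (c := -q) (by push_cast; ring)]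
    unfold Nf; ring

lemma unit_sq2 {p q r ε : ℤ} (hε : ε = 1 ∨ ε = -1) (hr : r ≠ 0) (hpq : IsCoprime p q)
    (hF : p ^ 3 - 2 * p ^ 2 * q + 3 * p * q ^ 2 - q ^ 3 = ε * r ^ 2) :
    ∃ κ α : 𝓞 K, Kap ρ κ ∧ (p : 𝓞 K) - q * (ρ ^ 2 - ρ) = κ * α ^ 2 := by
  refine unit_sq (b := 3) ?_ ?_ hε hr hpq (by linear_combination hF) ?_
  · push_cast; linear_combination (ρ ^ 3 - 3 * ρ ^ 2 + 2 * ρ + 1) * ρ_cube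
  · rw [nm_eq (a := -3) (b := 1) (c := 2) (by push_cast; linear_combination (3 * ρ - 6) * ρ_cube)]
    decide
  · rw [nm_eq (a := p) (b := q) (c := -q) (by push_cast; ring)]
    unfold Nf; ring

lemma split_sq {a b c : ℤ} (hc : IsCoprime a b) (h : a * b = c ^ 2) :
    ∃ σ u v : ℤ, (σ = 1 ∨ σ = -1) ∧ a = σ * u ^ 2 ∧ b = σ * v ^ 2 ∧ c = u * v := by
  have key : ∃ σ u v : ℤ, (σ = 1 ∨ σ = -1) ∧ a = σ * u ^ 2 ∧ b = σ * v ^ 2 := by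
    obtain ⟨u, hu⟩ := Int.sq_of_isCoprime hc h
    obtain ⟨v, hv⟩ := Int.sq_of_isCoprime hc.symm (by rw [mul_comm]; exact h)
    rcases hu with hu | hu <;> rcases hv with hv | hv
    · exact ⟨1, u, v, by simp, by simpa using hu, by simpa using hv⟩
    · rw [hu, hv] at h
      have h0 : u * v = 0 := by
        have : (u * v) ^ 2 = 0 := by nlinarith [sq_nonneg (u * v), sq_nonneg c]
        exact pow_eq_zero_iff two_ne_zero |>.1 this
      rcases mul_eq_zero.1 h0 with rfl | rfl
      · exact ⟨-1, 0, v, by simp, by simpa using hu, by simpa using hv⟩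
      · exact ⟨1, u, 0, by simp, by simpa using hu, by simpa using hv⟩
    · rw [hu, hv] at h
      have h0 : u * v = 0 := by
        have : (u * v) ^ 2 = 0 := by nlinarith [sq_nonneg (u * v), sq_nonneg c]
        exact pow_eq_zero_iff two_ne_zero |>.1 this
      rcases mul_eq_zero.1 h0 with rfl | rfl
      · exact ⟨1, 0, v, by simp, by simpa using hu, by simpa using hv⟩
      · exact ⟨-1, u, 0, by simp, by simpa using hu, by simpa using hv⟩
    · exact ⟨-1, u, v, by simp, by simpa using hu, by simpa using hv⟩
  obtain ⟨σ, u, v, hσ, ha, hb⟩ := key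
  have hσ2 : σ * σ = 1 := by rcases hσ with rfl | rfl <;> rfl
  have : c ^ 2 = (u * v) ^ 2 := by
    rw [← h, ha, hb]; linear_combination u ^ 2 * v ^ 2 * hσ2
  rcases sq_eq_sq_iff_eq_or_eq_neg.1 this with h1 | h1
  · exact ⟨σ, u, v, hσ, ha, hb, h1⟩
  · exact ⟨σ, u, -v, hσ, ha, by rw [hb]; ring, by rw [h1]; ring⟩

lemma z4_even {n : ℤ} (h : 2 ∣ n) : (n : ZMod 4) = 0 ∨ (n : ZMod 4) = 2 := by
  obtain ⟨k, rfl⟩ := h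
  push_cast
  generalize (k : ZMod 4) = u
  revert u; decide

lemma z4_odd {n : ℤ} (h : ¬ 2 ∣ n) : (n : ZMod 4) = 1 ∨ (n : ZMod 4) = 3 := by
  obtain ⟨k, rfl⟩ : ∃ k, n = 2 * k + 1 := ⟨n / 2, by omega⟩
  push_cast
  generalize (k : ZMod 4) = u
  revert u; decide

lemma int_odd_ne {n : ℤ} (h : ¬ 2 ∣ n) : n ≠ 0 := by rintro rfl; simp at h

lemma red_z2 (p q : ℤ) : red ((p : 𝓞 K) - q * (ρ ^ 2 - ρ)) = (↑p, ↑q, -↑q) := by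
  rw [red_eq (a := p) (b := q) (c := -q) (by push_cast; ring)]; simp

lemma odd_of_red {κ α : 𝓞 K} (h : ¬ evQ (red (κ * α ^ 2))) : ¬ 2 ∣ α := by
  rw [← even_iff] at h
  exact fun h2 => h (Dvd.dvd.mul_left (dvd_pow h2 two_ne_zero) _)

lemma check2 : ∀ k ∈ KK, ∀ t ∈ TT, mQ k t ≠ (2, 1, -1) := by decide +kernel
lemma check3 : ∀ k ∈ KK, ∀ t ∈ TT, mQ k t = (1, 0, 0) → k = (1, 0, 0) := by decide +kernel

lemma l92odd {S n r : ℤ} (hS : 2 ∣ S) (hn : ¬ 2 ∣ n) (hc : IsCoprime S n)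
    (h : S ^ 3 - 2 * S ^ 2 * n ^ 2 + 3 * S * n ^ 4 - n ^ 6 = r ^ 2) : False := by
  have h4 := congrArg (Int.cast : ℤ → ZMod 4) h
  push_cast at h4
  have hn4 : (n : ZMod 4) ^ 2 = 1 := by
    rcases z4_odd hn with e | e <;> rw [e] <;> decide
  have hr : r ≠ 0 := by
    rintro rfl
    apply hn
    have : 2 ∣ n ^ 6 := by
      have e : n ^ 6 = S * (S ^ 2 - 2 * S * n ^ 2 + 3 * n ^ 4) := by linear_combination -h
      rw [e]; exact Dvd.dvd.mul_right hS _
    exact Int.prime_two.dvd_of_dvd_pow this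
  rcases z4_even hS with e | e
  · rw [e, show (n : ZMod 4) ^ 6 = ((n : ZMod 4) ^ 2) ^ 3 by ring, hn4] at h4
    revert h4
    generalize (n : ZMod 4) = u
    generalize (r : ZMod 4) = v
    revert u v; decide
  · obtain ⟨κ, α, hk, hα⟩ := unit_sq2 (p := S) (q := n ^ 2) (r := r) (ε := 1) (Or.inl rfl) hr
      hc.pow_right (by linear_combination h)
    have hred := red_z2 S (n ^ 2)
    rw [e] at hred
    push_cast at hred
    rw [hn4] at hred
    push_cast at hα
    rw [hα] at hred
    have ho := odd_of_red (κ := κ) (α := α) (by rw [hred]; decide)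
    rw [red_mul] at hred
    exact check2 _ (mem_KK hk) _ (mem_TT ho) hred

lemma cop_of_prime {x y : ℤ} (h : ∀ p : ℤ, Prime p → p ∣ x → p ∣ y → False) : IsCoprime x y := by
  apply isCoprime_of_prime_dvd
  · rintro ⟨rfl, rfl⟩
    exact h 2 Int.prime_two (dvd_zero _) (dvd_zero _)
  · exact fun p hp h1 h2 => h p hp h1 h2

lemma cop_prime {x y p : ℤ} (hc : IsCoprime x y) (hp : Prime p) (h1 : p ∣ x) (h2 : p ∣ y) : False :=
  hp.not_isUnit (hc.isUnit_of_dvd' h1 h2)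

lemma pm_unit {σ : ℤ} (h : σ = 1 ∨ σ = -1) : IsUnit σ := Int.isUnit_iff.2 h

lemma l92_step {S m r : ℤ} (hc : IsCoprime S m) (hm0 : m ≠ 0) (hm : 2 ∣ m)
    (h : S ^ 3 - 2 * S ^ 2 * m ^ 2 + 3 * S * m ^ 4 - m ^ 6 = r ^ 2) :
    ∃ S' n r' : ℤ, IsCoprime S' n ∧ n ≠ 0 ∧ n.natAbs < m.natAbs ∧ (2 ∣ n ∨ 2 ∣ S') ∧
      S' ^ 3 - 2 * S' ^ 2 * n ^ 2 + 3 * S' * n ^ 4 - n ^ 6 = r' ^ 2 := by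
  have hS : ¬ 2 ∣ S := fun hS => cop_prime hc Int.prime_two hS hm
  have hm4 : (m : ZMod 4) ^ 2 = 0 := by
    rcases z4_even hm with e | e <;> rw [e] <;> decide
  have h4 := congrArg (Int.cast : ℤ → ZMod 4) h
  push_cast at h4
  rw [show (m : ZMod 4) ^ 6 = ((m : ZMod 4) ^ 2) ^ 3 by ring,
    show (m : ZMod 4) ^ 4 = ((m : ZMod 4) ^ 2) ^ 2 by ring, hm4] at h4
  have hS4 : (S : ZMod 4) = 1 := by
    rcases z4_odd hS with e | e
    · exact e
    · exfalso
      rw [e] at h4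
      revert h4
      generalize (r : ZMod 4) = v
      revert v; decide
  have hr : r ≠ 0 := by
    rintro rfl
    rw [hS4] at h4
    revert h4; decide
  obtain ⟨κ, α, hk, hα⟩ := unit_sq2 (p := S) (q := m ^ 2) (r := r) (ε := 1) (Or.inl rfl) hr
      hc.pow_right (by linear_combination h)
  have hred := red_z2 S (m ^ 2)
  push_cast at hred hα
  rw [hα, hm4, hS4, neg_zero] at hred
  have ho := odd_of_red (κ := κ) (α := α) (by rw [hred]; decide)
  rw [red_mul] at hred
  have hk1 : κ = 1 := KK_inj hk (Or.inl rfl) (by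
    rw [check3 _ (mem_KK hk) _ (mem_TT ho) hred, red_one])
  subst hk1
  obtain ⟨a, b, c, rfl⟩ := span_vv α
  obtain ⟨e1, e2, e3⟩ := prK.ext (a := S) (b := m ^ 2) (c := -m ^ 2)
    (a' := a ^ 2 + 2 * b * c) (b' := 2 * a * b + 2 * b * c + c ^ 2) (c' := b ^ 2 + 2 * a * c + c ^ 2)
    (by push_cast; linear_combination hα + (2 * b * c + c ^ 2 * ρ) * ρ_cube)
  obtain ⟨m', rfl⟩ := hm
  have hc2 : 2 ∣ c := Int.prime_two.dvd_of_dvd_pow (n := 2)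
    ⟨2 * m' ^ 2 - a * b - b * c, by linear_combination -e2⟩
  obtain ⟨l, rfl⟩ := hc2
  have hb2 : 2 ∣ b := Int.prime_two.dvd_of_dvd_pow (n := 2)
    ⟨-2 * m' ^ 2 - 2 * a * l - 2 * l ^ 2, by linear_combination -e3⟩
  obtain ⟨b, rfl⟩ := hb2
  obtain ⟨k, rfl⟩ : ∃ k, b = k - l := ⟨b + l, by ring⟩
  have ha : ¬ 2 ∣ a := by
    rintro ⟨t, rfl⟩
    exact hS ⟨2 * t ^ 2 + 4 * (k - l) * l, by linear_combination e1⟩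
  have hkl : k * -(a + k) = l ^ 2 := by
    have : 4 * (k * -(a + k)) = 4 * l ^ 2 := by linear_combination e2 + e3
    linarith
  have hka : IsCoprime k (-(a + k)) := by
    apply cop_of_prime
    intro p hp h1 h2
    have hl : p ∣ l := hp.dvd_of_dvd_pow (n := 2) (by rw [← hkl]; exact Dvd.dvd.mul_right h1 _)
    have ha : p ∣ a := by
      have := dvd_add (dvd_neg.1 (dvd_neg.2 ((dvd_neg).1 h2))) (dvd_neg.2 h1)
      simpa using this
    obtain ⟨k1, rfl⟩ := h1
    obtain ⟨l1, rfl⟩ := hl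
    obtain ⟨a1, rfl⟩ := ha
    refine cop_prime hc hp ?_ (hp.dvd_of_dvd_pow (n := 2) ?_)
    · rw [e1]
      exact ⟨p * a1 ^ 2 + 2 * (2 * (p * k1 - p * l1)) * (2 * l1), by ring⟩
    · rw [e2]
      exact ⟨2 * a1 * (2 * (p * k1 - p * l1)) + 2 * (2 * (p * k1 - p * l1)) * (2 * l1)
        + p * (2 * l1) ^ 2, by ring⟩
  obtain ⟨σ, κ, v, hσ, hk, hv, hl⟩ := split_sq hka hkl
  have hσ2 : σ * σ = 1 := by rcases hσ with rfl | rfl <;> rfl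
  obtain ⟨w, rfl⟩ : ∃ w, v = σ * w := ⟨σ * v, by linear_combination -v * hσ2⟩
  have hκw : IsCoprime κ w := by
    rw [hv, hk, isCoprime_mul_unit_left_left (pm_unit hσ), isCoprime_mul_unit_left_right (pm_unit hσ)] at hka
    have := (IsCoprime.pow_iff two_pos two_pos).1 hka
    rwa [isCoprime_mul_unit_left_right (pm_unit hσ)] at this
  have haa : a = -σ * (w ^ 2 + κ ^ 2) := by
    linear_combination -hv - hk - σ * w ^ 2 * hσ2
  have hm' : κ * (w ^ 3 - 2 * κ * w ^ 2 + 3 * κ ^ 2 * w - κ ^ 3) = m' ^ 2 := by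
    have : 4 * (κ * (w ^ 3 - 2 * κ * w ^ 2 + 3 * κ ^ 2 * w - κ ^ 3)) = 4 * m' ^ 2 := by
      rw [haa, hk, hl] at e2
      rcases hσ with rfl | rfl
      · linear_combination -e2
      · linear_combination -e2
    linarith
  have hcop2 : IsCoprime κ (w ^ 3 - 2 * κ * w ^ 2 + 3 * κ ^ 2 * w - κ ^ 3) := by
    rw [show w ^ 3 - 2 * κ * w ^ 2 + 3 * κ ^ 2 * w - κ ^ 3
      = w ^ 3 + κ * (-2 * w ^ 2 + 3 * κ * w - κ ^ 2) by ring]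
    exact IsCoprime.add_mul_left_right hκw.pow_right _
  obtain ⟨τ, n, r', hτ, hn, hr', hm''⟩ := split_sq hcop2 hm'
  have hτ2 : τ * τ = 1 := by rcases hτ with rfl | rfl <;> rfl
  have hm'0 : m' ≠ 0 := by rintro rfl; simp at hm0
  have hn0 : n ≠ 0 := by rintro rfl; simp at hm''; exact hm'0 hm''
  have hr0 : r' ≠ 0 := by rintro rfl; simp at hm''; exact hm'0 hm''
  refine ⟨τ * w, n, r', ?_, hn0, ?_, ?_, ?_⟩
  · rw [isCoprime_mul_unit_left_left (pm_unit hτ)]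
    rw [hn, isCoprime_mul_unit_left_left (pm_unit hτ)] at hκw
    exact ((IsCoprime.pow_left_iff two_pos).1 hκw).symm
  · rw [hm'', Int.natAbs_mul, Int.natAbs_mul]
    have h1 : 0 < n.natAbs := Int.natAbs_pos.2 hn0
    have h2 : 0 < r'.natAbs := Int.natAbs_pos.2 hr0
    simp only [show (2 : ℤ).natAbs = 2 from rfl]
    nlinarith
  · by_cases hn2 : 2 ∣ n
    · exact Or.inl hn2
    · right
      apply Dvd.dvd.mul_left
      by_contra hw
      apply ha
      rw [haa]
      apply Dvd.dvd.mul_left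
      have hκ : ¬ 2 ∣ κ := by
        rw [hn]
        intro hh
        have := (Int.prime_two.dvd_or_dvd hh).resolve_left (by rcases hτ with rfl | rfl <;> decide)
        exact hn2 (Int.prime_two.dvd_of_dvd_pow this)
      obtain ⟨x, hx⟩ : ∃ k, κ = 2 * k + 1 := ⟨κ / 2, by omega⟩
      obtain ⟨y, hy⟩ : ∃ k, w = 2 * k + 1 := ⟨w / 2, by omega⟩
      exact ⟨2 * x ^ 2 + 2 * x + 2 * y ^ 2 + 2 * y + 1, by rw [hx, hy]; ring⟩
  · rw [hn] at hr'
    rcases hτ with rfl | rfl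
    · linear_combination hr'
    · linear_combination -hr'

lemma l92 {S m r : ℤ} (hc : IsCoprime S m) (hm0 : m ≠ 0) (hm : 2 ∣ m)
    (h : S ^ 3 - 2 * S ^ 2 * m ^ 2 + 3 * S * m ^ 4 - m ^ 6 = r ^ 2) : False := by
  induction hN : m.natAbs using Nat.strong_induction_on generalizing S m r with
  | _ N ih =>
    obtain ⟨S', n, r', hc', hn0, hlt, hpar, h'⟩ := l92_step hc hm0 hm h
    by_cases hn : 2 ∣ n
    · exact ih n.natAbs (hN ▸ hlt) hc' hn0 hn h' rfl
    · exact l92odd (hpar.resolve_left hn) hn hc' h'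

lemma int_sq_of_rat {N : ℤ} {t : ℚ} (h : (N : ℚ) = t ^ 2) : ∃ k : ℤ, N = k ^ 2 := by
  have : IsSquare (N : ℚ) := ⟨t, by rw [h, sq]⟩
  obtain ⟨k, hk⟩ := Rat.isSquare_intCast_iff.1 this
  exact ⟨k, by rw [hk, sq]⟩

lemma lemma92 {s y : ℚ} (h : y ^ 2 = s ^ 3 - 2 * s ^ 2 + 3 * s - 1) : ¬ 2 ∣ s.den := by
  intro hd
  obtain ⟨n, hn⟩ : ∃ n : ℤ, n = s.num := ⟨_, rfl⟩
  obtain ⟨q, hq⟩ : ∃ q : ℤ, q = s.den := ⟨_, rfl⟩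
  have hq0 : 0 < q := by rw [hq]; exact_mod_cast s.den_pos
  have hq0' : (q : ℚ) ≠ 0 := by exact_mod_cast hq0.ne'
  have hs : s = n / q := by rw [hn, hq]; push_cast; exact (Rat.num_div_den s).symm
  have hc : IsCoprime n q := by
    rw [hn, hq]; exact Rat.isCoprime_num_den s
  have hq2 : 2 ∣ q := by rw [hq]; exact_mod_cast hd
  obtain ⟨k, hk⟩ := int_sq_of_rat (N := q * (n ^ 3 - 2 * n ^ 2 * q + 3 * n * q ^ 2 - q ^ 3))
    (t := y * q ^ 2) (by
      rw [mul_pow, h, hs]; push_cast; field_simp)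
  have hc2 : IsCoprime q (n ^ 3 - 2 * n ^ 2 * q + 3 * n * q ^ 2 - q ^ 3) := by
    rw [show n ^ 3 - 2 * n ^ 2 * q + 3 * n * q ^ 2 - q ^ 3
      = n ^ 3 + q * (-2 * n ^ 2 + 3 * n * q - q ^ 2) by ring]
    exact IsCoprime.add_mul_left_right hc.symm.pow_right _
  obtain ⟨σ, m, r, hσ, hm, hr, -⟩ := split_sq hc2 hk
  rcases hσ with rfl | rfl
  · rw [one_mul] at hm hr
    have hm0 : m ≠ 0 := by rintro rfl; simp at hm; exact hq0.ne' hm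
    rw [hm] at hr hq2 hc
    exact l92 (S := n) (m := m) (r := r) ((IsCoprime.pow_right_iff two_pos).1 hc) hm0
      (Int.prime_two.dvd_of_dvd_pow hq2) (by linear_combination hr)
  · nlinarith [sq_nonneg m]

/-- the form in which the lemma is used -/
lemma lemma92' {N D : ℤ} {y : ℚ} (hD0 : D ≠ 0) (hD : 8 ∣ D) (hN : ¬ 8 ∣ N)
    (h : y ^ 2 = (N / D : ℚ) ^ 3 - 2 * (N / D : ℚ) ^ 2 + 3 * (N / D : ℚ) - 1) : False := by
  apply lemma92 h
  by_contra hd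
  apply hN
  have hD0' : (D : ℚ) ≠ 0 := by exact_mod_cast hD0
  have e : ((N / D : ℚ).num : ℤ) * D = N * ((N / D : ℚ).den : ℤ) := by
    have h1 := Rat.num_div_den (N / D : ℚ)
    have h2 : ((N / D : ℚ).den : ℚ) ≠ 0 := by exact_mod_cast (N / D : ℚ).den_ne_zero
    rw [div_eq_div_iff h2 hD0'] at h1
    exact_mod_cast h1
  have h8 : (8 : ℤ) ∣ N * ((N / D : ℚ).den : ℤ) := by
    rw [← e]; exact Dvd.dvd.mul_left hD _
  refine IsCoprime.dvd_of_dvd_mul_right ?_ h8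
  rw [show (8 : ℤ) = 2 ^ 3 by norm_num]
  apply IsCoprime.pow_left
  rw [Int.prime_two.irreducible.coprime_iff_not_dvd]
  exact_mod_cast hd

lemma odd_form {n : ℤ} (h : ¬ 2 ∣ n) : ∃ k, n = 2 * k + 1 := ⟨n / 2, by omega⟩

lemma odd_mul {x y : ℤ} (hx : ¬ 2 ∣ x) (hy : ¬ 2 ∣ y) : ¬ 2 ∣ x * y := fun h =>
  (Int.prime_two.dvd_or_dvd h).elim hx hy

lemma odd_pow {x : ℤ} {n : ℕ} (hx : ¬ 2 ∣ x) : ¬ 2 ∣ x ^ n := fun h =>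
  hx (Int.prime_two.dvd_of_dvd_pow h)

lemma check_c1 : ∀ a b c d : ZMod 4, a ^ 2 - c ^ 2 = b ^ 2 → d ^ 2 = a ^ 2 * b ^ 4 - c ^ 6 →
    2 * c = 0 := by decide +kernel

lemma z4_two_mul {c : ℤ} (h : 2 * (c : ZMod 4) = 0) : 2 ∣ c := by
  by_contra hc
  rcases z4_odd hc with e | e <;> rw [e] at h <;> revert h <;> decide

/-- choose the sign so that a product of odd numbers is `-1` modulo 4 -/
lemma choose_sign {a d : ℤ} (ha : ¬ 2 ∣ a) (hd : ¬ 2 ∣ d) :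
    ∃ d' : ℤ, d' ^ 2 = d ^ 2 ∧ ∃ t, a * d' = 4 * t - 1 := by
  have h := odd_mul ha hd
  have : (∃ t, a * d = 4 * t - 1) ∨ ∃ t, a * d = 4 * t + 1 := by
    rcases (by omega : a * d % 4 = 1 ∨ a * d % 4 = 3) with h | h
    · exact Or.inr ⟨a * d / 4, by omega⟩
    · exact Or.inl ⟨a * d / 4 + 1, by omega⟩
  rcases this with ⟨t, ht⟩ | ⟨t, ht⟩
  · exact ⟨d, rfl, t, ht⟩
  · exact ⟨-d, by ring, -t, by linear_combination -ht⟩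

lemma sq_mod8 {x : ℤ} (h : ¬ 2 ∣ x) : ∃ t, x ^ 2 = 8 * t + 1 := by
  obtain ⟨k, rfl⟩ := odd_form h
  obtain ⟨t, ht⟩ := Int.even_mul_succ_self k
  exact ⟨t, by linear_combination 4 * ht⟩

lemma case1 {a b c d : ℤ} (ha : a ≠ 0) (hc0 : c ≠ 0) (hac : IsCoprime a c) (h1 : a ^ 2 - c ^ 2 = b ^ 2)
    (h2 : d ^ 2 = a ^ 2 * b ^ 4 - c ^ 6) : False := by
  have hc : 2 ∣ c := by
    apply z4_two_mul
    refine check_c1 a b c d ?_ ?_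
    · exact_mod_cast congrArg (Int.cast : ℤ → ZMod 4) h1
    · exact_mod_cast congrArg (Int.cast : ℤ → ZMod 4) h2
  have ha2 : ¬ 2 ∣ a := fun h => cop_prime hac Int.prime_two h hc
  have hb2 : ¬ 2 ∣ b := fun h => ha2 (Int.prime_two.dvd_of_dvd_pow (n := 2) (by
    rw [show a ^ 2 = b ^ 2 + c ^ 2 by linear_combination h1]
    exact dvd_add (dvd_pow h two_ne_zero) (dvd_pow hc two_ne_zero)))
  have hd2 : ¬ 2 ∣ d := fun h => odd_mul (odd_pow (n := 2) ha2) (odd_pow (n := 4) hb2) (by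
    rw [show a ^ 2 * b ^ 4 = d ^ 2 + c ^ 6 by linear_combination -h2]
    exact dvd_add (dvd_pow h two_ne_zero) (dvd_pow hc (by norm_num)))
  obtain ⟨e, he, t, ht⟩ := choose_sign ha2 hd2
  rw [← he] at h2
  obtain ⟨u, hu⟩ := sq_mod8 ha2
  obtain ⟨v, hv⟩ := sq_mod8 hb2
  have I : (a * c ^ 6 + (a ^ 3 - e) * (a ^ 4 + b ^ 4 - 2 * (a * e) - c ^ 4)) ^ 2
      = a ^ 2 * ((a ^ 4 + b ^ 4 - 2 * (a * e)) ^ 3 - 2 * (a ^ 4 + b ^ 4 - 2 * (a * e)) ^ 2 * c ^ 4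
        + 3 * (a ^ 4 + b ^ 4 - 2 * (a * e)) * c ^ 8 - c ^ 12) := by
    have hb4 : b ^ 4 = (a ^ 2 - c ^ 2) ^ 2 := by rw [h1]; ring
    rw [hb4] at h2 ⊢
    linear_combination 4 * a ^ 2 * (e + a * c ^ 2 - a ^ 3) ^ 2 * h2
  refine lemma92' (N := a ^ 4 + b ^ 4 - 2 * (a * e)) (D := c ^ 4)
    (y := ((a * c ^ 6 + (a ^ 3 - e) * (a ^ 4 + b ^ 4 - 2 * (a * e) - c ^ 4) : ℤ) : ℚ) / (a * c ^ 6))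
    (pow_ne_zero 4 hc0) ?_ ?_ ?_
  · obtain ⟨k, rfl⟩ := hc
    exact ⟨2 * k ^ 4, by ring⟩
  · rw [ht]
    rintro ⟨w, hw⟩
    have e1 : a ^ 4 = 8 * (8 * u ^ 2 + 2 * u) + 1 := by
      rw [show a ^ 4 = (a ^ 2) ^ 2 by ring, hu]; ring
    have e2 : b ^ 4 = 8 * (8 * v ^ 2 + 2 * v) + 1 := by
      rw [show b ^ 4 = (b ^ 2) ^ 2 by ring, hv]; ring
    rw [e1, e2] at hw
    omega
  · rw [div_pow, ← Int.cast_pow, I]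
    have ha' : (a : ℚ) ≠ 0 := by exact_mod_cast ha
    have hc' : (c : ℚ) ≠ 0 := by exact_mod_cast hc0
    push_cast
    field_simp

lemma case3a {a b c d : ℤ} (ha : a ≠ 0) (hc0 : 0 < c) (hac : IsCoprime a c)
    (h1 : a ^ 2 + b ^ 2 = c ^ 2) (h2 : d ^ 2 = c ^ 6 - a ^ 2 * b ^ 4) (ha2 : 2 ∣ a) : False := by
  have hc2 : ¬ 2 ∣ c := fun h => cop_prime hac Int.prime_two ha2 h
  have hsp : ∃ m n : ℤ, c + a = m ^ 2 ∧ c - a = n ^ 2 := by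
    have hcop : IsCoprime (c + a) (c - a) := by
      apply cop_of_prime
      intro p hp g1 g2
      have hp2 : ¬ p ∣ 2 := by
        intro hp2
        have : Associated p 2 := hp.associated_of_dvd Int.prime_two hp2
        have h3 : 2 ∣ c + a := this.dvd_iff_dvd_left.1 g1
        exact hc2 (by simpa using dvd_sub h3 ha2)
      have g3 : p ∣ 2 * c := by
        rw [show 2 * c = (c + a) + (c - a) by ring]; exact dvd_add g1 g2
      have g4 : p ∣ 2 * a := by
        rw [show 2 * a = (c + a) - (c - a) by ring]; exact dvd_sub g1 g2
      exact cop_prime hac hp ((hp.dvd_or_dvd g4).resolve_left hp2) ((hp.dvd_or_dvd g3).resolve_left hp2)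
    obtain ⟨σ, m, n, hσ, hm, hn, -⟩ := split_sq (c := b) hcop (by linear_combination -h1)
    rcases hσ with rfl | rfl
    · exact ⟨m, n, by linarith, by linarith⟩
    · nlinarith [sq_nonneg m, sq_nonneg n]
  obtain ⟨m, n, hm, hn⟩ := hsp
  have hsp2 : ∃ k : ℤ, c ^ 3 + a * b ^ 2 = k ^ 2 := by
    have hcop : IsCoprime (c ^ 3 + a * b ^ 2) (c ^ 3 - a * b ^ 2) := by
      apply cop_of_prime
      intro p hp g1 g2
      have hp2 : ¬ p ∣ 2 := by
        intro hp2
        have : Associated p 2 := hp.associated_of_dvd Int.prime_two hp2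
        have h3 : 2 ∣ c ^ 3 + a * b ^ 2 := this.dvd_iff_dvd_left.1 g1
        exact odd_pow (n := 3) hc2 ((dvd_add_left (Dvd.dvd.mul_right ha2 (b ^ 2))).1 h3)
      have g3 : p ∣ 2 * c ^ 3 := by
        rw [show 2 * c ^ 3 = (c ^ 3 + a * b ^ 2) + (c ^ 3 - a * b ^ 2) by ring]; exact dvd_add g1 g2
      have g4 : p ∣ 2 * (a * b ^ 2) := by
        rw [show 2 * (a * b ^ 2) = (c ^ 3 + a * b ^ 2) - (c ^ 3 - a * b ^ 2) by ring]
        exact dvd_sub g1 g2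
      have g5 : p ∣ c := hp.dvd_of_dvd_pow ((hp.dvd_or_dvd g3).resolve_left hp2)
      have g6 : p ∣ a := by
        rcases hp.dvd_or_dvd ((hp.dvd_or_dvd g4).resolve_left hp2) with g | g
        · exact g
        · apply hp.dvd_of_dvd_pow (n := 2)
          rw [show a ^ 2 = c ^ 2 - b ^ 2 by linear_combination h1]
          exact dvd_sub (dvd_pow g5 two_ne_zero) g
      exact cop_prime hac hp g6 g5
    obtain ⟨σ, k, l, hσ, hk, hl, -⟩ := split_sq (c := d) hcop (by linear_combination -h2)
    rcases hσ with rfl | rfl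
    · exact ⟨k, by linarith⟩
    · have : 0 < c ^ 3 := by positivity
      nlinarith [sq_nonneg k, sq_nonneg l]
  obtain ⟨k, hk⟩ := hsp2
  have hm2 : ¬ 2 ∣ m := fun h => hc2 (by
    have : 2 ∣ m ^ 2 := dvd_pow h two_ne_zero
    omega)
  have hn2 : ¬ 2 ∣ n := fun h => hc2 (by
    have : 2 ∣ n ^ 2 := dvd_pow h two_ne_zero
    omega)
  have hk2 : ¬ 2 ∣ k := fun h => odd_pow (n := 3) hc2 (by
    have h3 : 2 ∣ k ^ 2 := dvd_pow h two_ne_zero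
    rw [← hk] at h3
    exact (dvd_add_left (Dvd.dvd.mul_right ha2 (b ^ 2))).1 h3)
  have hm0 : m ≠ 0 := int_odd_ne hm2
  have ha4 : 4 ∣ a := by
    obtain ⟨u, hu⟩ := sq_mod8 hm2
    obtain ⟨v, hv⟩ := sq_mod8 hn2
    omega
  obtain ⟨e, he, t, ht⟩ := choose_sign hm2 hk2
  rw [← he] at hk
  have I : (a ^ 3 * m + (m ^ 3 - e) * (2 * c ^ 2 + 2 * c * a + a ^ 2 - 2 * (m * e) - a ^ 2)) ^ 2
      = m ^ 2 * ((2 * c ^ 2 + 2 * c * a + a ^ 2 - 2 * (m * e)) ^ 3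
        - 2 * (2 * c ^ 2 + 2 * c * a + a ^ 2 - 2 * (m * e)) ^ 2 * a ^ 2
        + 3 * (2 * c ^ 2 + 2 * c * a + a ^ 2 - 2 * (m * e)) * a ^ 4 - a ^ 6) := by
    have hb' : b ^ 2 = c ^ 2 - a ^ 2 := by linear_combination h1
    have hc' : c = m ^ 2 - a := by linear_combination hm
    rw [hb', hc'] at hk
    rw [hc']
    linear_combination -4 * m ^ 2 * (e - m ^ 3 + a * m) ^ 2 * hk
  refine lemma92' (N := 2 * c ^ 2 + 2 * c * a + a ^ 2 - 2 * (m * e)) (D := a ^ 2)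
    (y := ((a ^ 3 * m + (m ^ 3 - e) * (2 * c ^ 2 + 2 * c * a + a ^ 2 - 2 * (m * e) - a ^ 2) : ℤ) : ℚ)
      / (a ^ 3 * m))
    (pow_ne_zero 2 ha) ?_ ?_ ?_
  · obtain ⟨k, rfl⟩ := ha4
    exact ⟨2 * k ^ 2, by ring⟩
  · rw [ht]
    rintro ⟨w, hw⟩
    obtain ⟨k, rfl⟩ := ha4
    obtain ⟨u, hu⟩ := sq_mod8 hc2
    rw [hu] at hw
    have : 2 * (8 * u + 1) + 8 * (c * k) + 8 * (2 * k ^ 2) - 2 * (4 * t - 1) = 8 * w := by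
      linear_combination hw
    omega
  · rw [div_pow, ← Int.cast_pow, I]
    have ha' : (a : ℚ) ≠ 0 := by exact_mod_cast ha
    have hm' : (m : ℚ) ≠ 0 := by exact_mod_cast hm0
    push_cast
    field_simp

lemma check_c3 : ∀ a b c : ZMod 4, a ^ 2 + b ^ 2 = c ^ 2 → 2 * a = 0 ∨ 2 * b = 0 := by
  decide +kernel

lemma check4 : ∀ k ∈ KK, ∀ t ∈ TT, mQ k t = (1, 0, -1) → k = (0, 3, 0) := by decide +kernel

lemma case3b {a b c d : ℤ} (hb : b ≠ 0) (hac : IsCoprime a c)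
    (h1 : a ^ 2 + b ^ 2 = c ^ 2) (h2 : d ^ 2 = c ^ 6 - a ^ 2 * b ^ 4) (ha2 : ¬ 2 ∣ a)
    (hb2 : 2 ∣ b) : False := by
  have hc2 : ¬ 2 ∣ c := fun h => ha2 (Int.prime_two.dvd_of_dvd_pow (n := 2) (by
    rw [show a ^ 2 = c ^ 2 - b ^ 2 by linear_combination h1]
    exact dvd_sub (dvd_pow h two_ne_zero) (dvd_pow hb2 two_ne_zero)))
  have hd0 : d ≠ 0 := by
    rintro rfl
    apply odd_pow (n := 6) hc2
    rw [show c ^ 6 = b * (a ^ 2 * b ^ 3) by linear_combination -h2]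
    exact Dvd.dvd.mul_right hb2 _
  obtain ⟨κ, α, hk, hα⟩ := unit_sq1 (p := a ^ 2) (q := c ^ 2) (r := d) (ε := -1) (Or.inr rfl) hd0
    hac.pow (by
      have hb' : b ^ 4 = (c ^ 2 - a ^ 2) ^ 2 := by
        rw [show c ^ 2 - a ^ 2 = b ^ 2 by linear_combination -h1]; ring
      rw [hb'] at h2
      linear_combination h2)
  have hsq : ∀ n : ℤ, ¬ 2 ∣ n → ((n ^ 2 : ℤ) : ZMod 4) = 1 := by
    intro n hn
    push_cast
    rcases z4_odd hn with e | e <;> rw [e] <;> decide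
  have hred : red (((a ^ 2 : ℤ) : 𝓞 K) - ((c ^ 2 : ℤ) : 𝓞 K) * ρ ^ 2) = (1, 0, -1) := by
    rw [red_eq (a := a ^ 2) (b := 0) (c := -c ^ 2) (by push_cast; ring), Int.cast_neg, hsq a ha2,
      hsq c hc2, Int.cast_zero]
  rw [hα] at hred
  have ho := odd_of_red (κ := κ) (α := α) (by rw [hred]; decide)
  rw [red_mul] at hred
  have hk1 : κ = -ρ := KK_inj hk (Or.inr (Or.inr (Or.inr rfl))) (by
    rw [check4 _ (mem_KK hk) _ (mem_TT ho) hred, red_neg, red_ρ]; decide)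
  subst hk1
  have h1' : (a : 𝓞 K) ^ 2 + b ^ 2 = c ^ 2 := by exact_mod_cast h1
  push_cast at hα
  have E1 : (ρ * α) ^ 2 - (c : 𝓞 K) ^ 2 = ρ * (b : 𝓞 K) ^ 2 := by
    linear_combination ρ * hα + (c : 𝓞 K) ^ 2 * ρ_cube - ρ * h1'
  have E2 : (ρ * α) ^ 2 - (a : 𝓞 K) ^ 2 = ρ ^ 3 * (b : 𝓞 K) ^ 2 := by
    linear_combination ρ * hα + (a : 𝓞 K) ^ 2 * ρ_cube - ρ ^ 3 * h1'
  refine no_sol (A := ρ * α) (B := c) (C := a) (D := b) ⟨E1, E2, ?_, ?_, ?_⟩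
  · have hcb : IsCoprime c b := by
      apply cop_of_prime
      intro p hp g1 g2
      refine cop_prime hac hp (hp.dvd_of_dvd_pow (n := 2) ?_) g1
      rw [show a ^ 2 = c ^ 2 - b ^ 2 by linear_combination h1]
      exact dvd_sub (dvd_pow g1 two_ne_zero) (dvd_pow g2 two_ne_zero)
    have hcb' : IsCoprime (c : 𝓞 K) b := by
      have := hcb.map (Int.castRingHom (𝓞 K))
      simpa using this
    rw [← IsCoprime.pow_left_iff (m := 2) two_pos,
      show (ρ * α) ^ 2 = (c : 𝓞 K) ^ 2 + b * (ρ * b) by linear_combination E1]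
    exact IsCoprime.add_mul_left_left hcb'.pow_left _
  · exact (two_int b).2 hb2
  · exact_mod_cast hb

lemma case3 {a b c d : ℤ} (ha : a ≠ 0) (hb : b ≠ 0) (hc0 : c ≠ 0) (hac : IsCoprime a c)
    (h1 : a ^ 2 + b ^ 2 = c ^ 2) (h2 : d ^ 2 = c ^ 6 - a ^ 2 * b ^ 4) : False := by
  have h4 : 2 ∣ a ∨ 2 ∣ b := by
    rcases check_c3 a b c (by exact_mod_cast congrArg (Int.cast : ℤ → ZMod 4) h1) with h | h
    · exact Or.inl (z4_two_mul h)
    · exact Or.inr (z4_two_mul h)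
  by_cases ha2 : 2 ∣ a
  · rcases lt_or_gt_of_ne hc0 with hc | hc
    · exact case3a (b := b) (c := -c) (d := d) ha (by omega) hac.neg_right (by linear_combination h1)
        (by linear_combination h2) ha2
    · exact case3a ha hc hac h1 h2 ha2
  · exact case3b hb hac h1 h2 ha2 (h4.resolve_left ha2)

lemma main_int {p q k : ℤ} (hq : 0 < q) (hc : IsCoprime p q) (hp0 : p ≠ 0) (hpq : p ≠ q)
    (h : q * (p * ((p - q) * (p ^ 3 - 2 * p ^ 2 * q + p * q ^ 2 - q ^ 3))) = k ^ 2) : False := by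
  have cpq : IsCoprime p (p - q) := by
    rw [show p - q = -q + p * 1 by ring]
    exact IsCoprime.add_mul_left_right hc.neg_right 1
  have cqpq : IsCoprime q (p - q) := by
    rw [show p - q = p + q * (-1) by ring]
    exact IsCoprime.add_mul_left_right hc.symm _
  have cpG : IsCoprime p (p ^ 3 - 2 * p ^ 2 * q + p * q ^ 2 - q ^ 3) := by
    rw [show p ^ 3 - 2 * p ^ 2 * q + p * q ^ 2 - q ^ 3 = -q ^ 3 + p * (p - q) ^ 2 by ring]
    exact IsCoprime.add_mul_left_right hc.pow_right.neg_right _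
  have cqG : IsCoprime q (p ^ 3 - 2 * p ^ 2 * q + p * q ^ 2 - q ^ 3) := by
    rw [show p ^ 3 - 2 * p ^ 2 * q + p * q ^ 2 - q ^ 3
      = p ^ 3 + q * (-2 * p ^ 2 + p * q - q ^ 2) by ring]
    exact IsCoprime.add_mul_left_right hc.symm.pow_right _
  have cdG : IsCoprime (p - q) (p ^ 3 - 2 * p ^ 2 * q + p * q ^ 2 - q ^ 3) := by
    rw [show p ^ 3 - 2 * p ^ 2 * q + p * q ^ 2 - q ^ 3 = -q ^ 3 + (p - q) * (p * (p - q)) by ring]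
    exact IsCoprime.add_mul_left_right cqpq.symm.pow_right.neg_right _
  obtain ⟨μ, c, e, hμ, hqc, he, -⟩ := split_sq (hc.symm.mul_right (cqpq.mul_right cqG)) h
  have hμ1 : μ = 1 := by
    rcases hμ with h | rfl
    · exact h
    · nlinarith [sq_nonneg c]
  subst hμ1
  rw [one_mul] at hqc he
  obtain ⟨σ, a, f, hσ, hpa, hf, -⟩ := split_sq (cpq.mul_right cpG) he
  have hσ2 : σ * σ = 1 := by rcases hσ with rfl | rfl <;> rfl
  obtain ⟨τ, b, d, hτ, hb, hd, -⟩ := split_sq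
    ((isCoprime_mul_unit_left_right (pm_unit hσ) _ _).2 cdG) (c := f)
    (by linear_combination σ * hf + f ^ 2 * hσ2)
  have ha0 : a ≠ 0 := by rintro rfl; simp at hpa; exact hp0 hpa
  have hb0 : b ≠ 0 := by rintro rfl; simp at hb; omega
  have hc0 : c ≠ 0 := by rintro rfl; simp at hqc; omega
  have hac : IsCoprime a c := by
    rw [hpa, hqc, isCoprime_mul_unit_left_left (pm_unit hσ)] at hc
    exact (IsCoprime.pow_iff two_pos two_pos).1 hc
  have hG : p ^ 3 - 2 * p ^ 2 * q + p * q ^ 2 - q ^ 3 = p * (p - q) ^ 2 - q ^ 3 := by ring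
  rw [hG] at hd
  rcases hσ with rfl | rfl <;> rcases hτ with rfl | rfl
  · rw [hb, hpa, hqc] at hd
    rw [hpa, hqc] at hb
    exact case1 (b := b) (d := d) ha0 hc0 hac (by linear_combination hb) (by linear_combination -hd)
  · rw [hb, hpa, hqc] at hd
    rw [hpa, hqc] at hb
    exact case3 (b := b) (d := d) ha0 hb0 hc0 hac (by linear_combination hb) (by linear_combination hd)
  · nlinarith [sq_nonneg a, sq_nonneg b]
  · have h3 : 0 < q ^ 3 := by positivity
    have h4 : p ≤ 0 := by nlinarith [sq_nonneg a]
    nlinarith [sq_nonneg d, mul_nonneg (neg_nonneg.2 h4) (sq_nonneg (p - q))]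

end Plastic

theorem stmt_12 (x y : ℚ) :
    y ^ 2 = x * (x - 1) * (x ^ 3 - 2 * x ^ 2 + x - 1) ↔
      (x = 0 ∧ y = 0) ∨ (x = 1 ∧ y = 0) := by
  constructor
  · intro h
    by_cases hx0 : x = 0
    · subst hx0
      left
      simpa using h
    by_cases hx1 : x = 1
    · subst hx1
      right
      simpa using h
    exfalso
    obtain ⟨n, hn⟩ : ∃ n : ℤ, n = x.num := ⟨_, rfl⟩
    obtain ⟨q, hq⟩ : ∃ q : ℤ, q = x.den := ⟨_, rfl⟩
    have hq0 : 0 < q := by rw [hq]; exact_mod_cast x.den_pos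
    have hq0' : (q : ℚ) ≠ 0 := by exact_mod_cast hq0.ne'
    have hs : x = n / q := by rw [hn, hq]; push_cast; exact (Rat.num_div_den x).symm
    have hc : IsCoprime n q := by
      rw [hn, hq]; exact Rat.isCoprime_num_den x
    obtain ⟨k, hk⟩ := Plastic.int_sq_of_rat
      (N := q * (n * ((n - q) * (n ^ 3 - 2 * n ^ 2 * q + n * q ^ 2 - q ^ 3))))
      (t := y * q ^ 3) (by
        rw [mul_pow, h, hs]; push_cast; field_simp)
    refine Plastic.main_int hq0 hc ?_ ?_ hk
    · rintro rfl
      exact hx0 (by rw [hs]; simp)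
    · rintro rfl
      exact hx1 (by rw [hs]; field_simp)
  · rintro (⟨rfl, rfl⟩ | ⟨rfl, rfl⟩) <;> norm_num
end

section
/- The genus-two hyperelliptic curve y^2 = x^6 - 2x^4 + x^2 - 1 has no rational affine points, i.e., there is no pair (x, y) ∈ ℚ × ℚ with y^2 = x^6 - 2x^4 + x^2 - 1. -/
/-- The Eisenstein integers `ℤ[ω]`, with `ω² = -1 - ω`. -/
abbrev Eis : Type := QuadraticAlgebra ℤ (-1) (-1)

namespace Eis

/-- The norm form. -/
def N (z : Eis) : ℤ := z.re ^ 2 - z.re * z.im + z.im ^ 2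

theorem N_mul (z w : Eis) : N (z * w) = N z * N w := by
  simp only [N, QuadraticAlgebra.re_mul, QuadraticAlgebra.im_mul]; ring

theorem N_nonneg (z : Eis) : 0 ≤ N z := by
  unfold N; nlinarith [sq_nonneg (z.re - z.im), sq_nonneg (z.re), sq_nonneg z.im]

theorem N_eq_zero {z : Eis} (h : N z = 0) : z = 0 := by
  unfold N at h
  have h1 : z.re = 0 := by
    have : z.re ^ 2 = 0 := by nlinarith [sq_nonneg (z.re - 2 * z.im), sq_nonneg z.re]
    exact pow_eq_zero_iff (two_ne_zero) |>.1 this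
  have h2 : z.im = 0 := by
    rw [h1] at h
    have : z.im ^ 2 = 0 := by linarith
    exact pow_eq_zero_iff (two_ne_zero) |>.1 this
  ext <;> simp [h1, h2]

theorem N_pos {z : Eis} (h : z ≠ 0) : 0 < N z :=
  lt_of_le_of_ne (N_nonneg z) fun h' => h (N_eq_zero h'.symm)

instance : NoZeroDivisors Eis where
  eq_zero_or_eq_zero_of_mul_eq_zero := by
    intro a b h
    have h1 : N a * N b = 0 := by rw [← N_mul, h]; simp [N]
    rcases mul_eq_zero.1 h1 with h | h
    · exact Or.inl (N_eq_zero h)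
    · exact Or.inr (N_eq_zero h)

instance : IsDomain Eis := NoZeroDivisors.to_isDomain _

theorem round_aux (p n : ℤ) (hn : 0 < n) : ∃ q : ℤ, (2 * (p - n * q)) ^ 2 ≤ n ^ 2 := by
  refine ⟨(2 * p + n) / (2 * n), ?_⟩
  have h1 := Int.emod_add_mul_ediv (2 * p + n) (2 * n)
  have h2 := Int.emod_nonneg (2 * p + n) (b := 2 * n) (by omega)
  have h3 := Int.emod_lt_of_pos (2 * p + n) (b := 2 * n) (by omega)
  set q := (2 * p + n) / (2 * n)
  apply sq_le_sq'
  · nlinarith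
  · nlinarith

theorem exists_quot (x y : Eis) (hy : y ≠ 0) : ∃ q : Eis, N (x - y * q) < N y := by
  have hn := N_pos hy
  obtain ⟨s, hs⟩ := round_aux (x.re * y.re - x.re * y.im + x.im * y.im) (N y) hn
  obtain ⟨t, ht⟩ := round_aux (x.im * y.re - x.re * y.im) (N y) hn
  refine ⟨⟨s, t⟩, ?_⟩
  set e := (x.re * y.re - x.re * y.im + x.im * y.im) - N y * s with he
  set f := (x.im * y.re - x.re * y.im) - N y * t with hf
  have key : N (x - y * ⟨s, t⟩) * N y = e ^ 2 - e * f + f ^ 2 := by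
    rw [he, hf]
    simp only [N, QuadraticAlgebra.re_mul, QuadraticAlgebra.im_mul, QuadraticAlgebra.re_sub,
      QuadraticAlgebra.im_sub]
    ring
  have : N (x - y * ⟨s, t⟩) * N y < N y * N y := by
    rw [key]
    nlinarith [sq_nonneg (e + f), mul_pos hn hn]
  exact lt_of_mul_lt_mul_right this hn.le

open Classical in
/-- Euclidean structure on the Eisenstein integers. -/
noncomputable instance instEuclid : EuclideanDomain Eis where
  quotient x y := if h : y = 0 then 0 else (exists_quot x y h).choose
  quotient_zero := by intro a; simp
  remainder x y := if h : y = 0 then x else x - y * (exists_quot x y h).choose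
  quotient_mul_add_remainder_eq := by
    intro a b
    by_cases h : b = 0
    · simp [h]
    · simp [h]
  r x y := (N x).toNat < (N y).toNat
  r_wellFounded := (measure fun x => (N x).toNat).wf
  remainder_lt := by
    intro a b h
    simp only [h, dite_false]
    have h1 := (exists_quot a b h).choose_spec
    have h2 := N_nonneg (a - b * (exists_quot a b h).choose)
    omega
  mul_left_not_lt := by
    intro a b h
    have h1 := N_pos h
    have h2 := N_nonneg a
    rw [N_mul]
    have : N a ≤ N a * N b := by nlinarith
    omega

theorem unit_cases (u : Eisˣ) : ∃ a b : ℤ, (u : Eis) = ⟨a, b⟩ ∧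
    ((a = 1 ∧ b = 0) ∨ (a = -1 ∧ b = 0) ∨ (a = 0 ∧ b = 1) ∨ (a = 0 ∧ b = -1) ∨
      (a = 1 ∧ b = 1) ∨ (a = -1 ∧ b = -1)) := by
  refine ⟨(u : Eis).re, (u : Eis).im, rfl, ?_⟩
  have h : N (u : Eis) * N ((u⁻¹ : Eisˣ) : Eis) = 1 := by
    rw [← N_mul]; simp [N, QuadraticAlgebra.re_one, QuadraticAlgebra.im_one]
  have h1 : N (u : Eis) = 1 :=
    (Int.eq_one_or_neg_one_of_mul_eq_one h).resolve_right (by have := N_nonneg (u : Eis); omega)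
  unfold N at h1
  generalize (u : Eis).re = a at *
  generalize (u : Eis).im = b at *
  have ha : -1 ≤ a ∧ a ≤ 1 := by constructor <;> nlinarith [sq_nonneg (a - 2 * b)]
  have hb : -1 ≤ b ∧ b ≤ 1 := by constructor <;> nlinarith [sq_nonneg (b - 2 * a)]
  obtain ⟨h3, h4⟩ := ha
  obtain ⟨h5, h6⟩ := hb
  interval_cases a <;> interval_cases b <;> simp_all

end Eis

theorem exists_unit_cube (X Y T : ℤ) (h : X ^ 2 + 27 * Y ^ 2 = T ^ 3) (hc : IsCoprime T (2 * X)) :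
    ∃ (u : Eisˣ) (z : Eis), z ^ 3 * u = (⟨X + 3 * Y, 6 * Y⟩ : Eis) := by
  have hmul : (⟨X + 3 * Y, 6 * Y⟩ : Eis) * ⟨X - 3 * Y, -6 * Y⟩ = (⟨T, 0⟩ : Eis) ^ 3 := by
    have : (⟨T, 0⟩ : Eis) ^ 3 = ⟨T ^ 3, 0⟩ := by
      ext <;> simp [pow_succ]
    rw [this, ← h]
    ext
    · simp; ring
    · simp; ring
  have hcop : IsCoprime (⟨X + 3 * Y, 6 * Y⟩ : Eis) ⟨X - 3 * Y, -6 * Y⟩ := by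
    obtain ⟨a, b, hab⟩ := (hc.pow_left (m := 3))
    refine ⟨⟨b, 0⟩ + ⟨a, 0⟩ * ⟨X - 3 * Y, -6 * Y⟩, ⟨b, 0⟩, ?_⟩
    ext
    · simp [QuadraticAlgebra.re_one]
      rw [← h] at hab
      linear_combination hab
    · simp [QuadraticAlgebra.im_one]
      ring
  obtain ⟨z, u, hu⟩ := exists_associated_pow_of_mul_eq_pow' hcop hmul
  exact ⟨u, z, hu⟩

theorem cube_lemma (X Y T : ℤ) (h : X ^ 2 + 27 * Y ^ 2 = T ^ 3) (hc : IsCoprime T (2 * X)) :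
    ∃ c d : ℤ, X = c ^ 3 - 9 * c * d ^ 2 ∧ Y = d * (c ^ 2 - d ^ 2) ∧ T = c ^ 2 + 3 * d ^ 2 := by
  have hT : Odd T := by
    rw [← Int.not_even_iff_odd]
    rintro ⟨t, ht⟩
    obtain ⟨a, b, hab⟩ := hc
    rw [ht] at hab
    have : 2 * (a * t + b * X) = 1 := by linear_combination hab
    omega
  have hpar : (X + Y) % 2 = 1 := by
    have h1 : Odd (T ^ 3) := hT.pow
    rw [← h] at h1
    have : Odd (X + Y) := by
      by_contra h2
      rw [Int.not_odd_iff_even] at h2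
      apply (Int.not_even_iff_odd.2 h1)
      have h3 : X ^ 2 + 27 * Y ^ 2 = (X + Y) * (X - Y) + 2 * (14 * Y ^ 2) := by ring
      rw [h3]
      exact (h2.mul_right _).add (even_two_mul _)
    exact Int.odd_iff.1 this
  -- It is enough to find c, d matching X and Y.
  suffices hs : ∃ c d : ℤ, X = c ^ 3 - 9 * c * d ^ 2 ∧ Y = d * (c ^ 2 - d ^ 2) by
    obtain ⟨c, d, h1, h2⟩ := hs
    refine ⟨c, d, h1, h2, ?_⟩
    have : T ^ 3 = (c ^ 2 + 3 * d ^ 2) ^ 3 := by rw [← h, h1, h2]; ring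
    exact (Odd.strictMono_pow (by decide : Odd 3)).injective this
  obtain ⟨u, z, hz⟩ := exists_unit_cube X Y T h hc
  obtain ⟨a, b, hu, hab⟩ := Eis.unit_cases u
  rw [hu] at hz
  obtain ⟨x, y⟩ := z
  have hre := congrArg QuadraticAlgebra.re hz
  have him := congrArg QuadraticAlgebra.im hz
  simp only [pow_succ, pow_zero, one_mul, QuadraticAlgebra.re_mul, QuadraticAlgebra.im_mul] at hre him
  obtain ⟨k, hk⟩ : ∃ k, x * y * (x - y) = 2 * k := by
    have : Even (x * y * (x - y)) := by
      rcases Int.even_or_odd x with hx | hx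
      · exact (hx.mul_right _).mul_right _
      · rcases Int.even_or_odd y with hy | hy
        · exact (hy.mul_left _).mul_right _
        · exact (hx.sub_odd hy).mul_left _
    exact this.exists_two_nsmul _ |>.imp (by intro a h; simpa using h)
  -- the case of a genuine cube
  have main : ∀ x y : ℤ, x ^ 3 - 3 * x * y ^ 2 + y ^ 3 = X + 3 * Y →
      x * y * (x - y) = 2 * Y →
      ∃ c d : ℤ, X = c ^ 3 - 9 * c * d ^ 2 ∧ Y = d * (c ^ 2 - d ^ 2) := by
    have main' : ∀ x y : ℤ, Even y → x ^ 3 - 3 * x * y ^ 2 + y ^ 3 = X + 3 * Y →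
        x * y * (x - y) = 2 * Y →
        ∃ c d : ℤ, X = c ^ 3 - 9 * c * d ^ 2 ∧ Y = d * (c ^ 2 - d ^ 2) := by
      rintro x y ⟨d, rfl⟩ h1 h2
      refine ⟨x - d, d, ?_, ?_⟩
      · linarith
      · linarith
    intro x y h1 h2
    rcases Int.even_or_odd y with hy | hy
    · exact main' x y hy h1 h2
    rcases Int.even_or_odd x with hx | hx
    · exact main' (y - x) (-x) hx.neg (by linear_combination h1) (by linear_combination h2)
    · exact main' (-y) (x - y) (hx.sub_odd hy) (by linear_combination h1) (by linear_combination h2)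
  rcases hab with ⟨rfl, rfl⟩ | ⟨rfl, rfl⟩ | ⟨rfl, rfl⟩ | ⟨rfl, rfl⟩ | ⟨rfl, rfl⟩ | ⟨rfl, rfl⟩
  · exact main x y (by linear_combination hre) (by linarith)
  · exact main (-x) (-y) (by linear_combination hre) (by linarith)
  all_goals
    exfalso
    ring_nf at hre him hk
    generalize x ^ 2 * y = m1 at *
    generalize x * y ^ 2 = m2 at *
    omega

theorem mod23 (a b : ℤ) (h : (23 : ℤ) ∣ 27 * a ^ 2 + 4 * b ^ 2) : (23 : ℤ) ∣ a ∧ (23 : ℤ) ∣ b := by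
  have key : ∀ x y : ZMod 23, 27 * x ^ 2 + 4 * y ^ 2 = 0 → x = 0 ∧ y = 0 := by decide
  have h1 := (ZMod.intCast_zmod_eq_zero_iff_dvd _ 23).2 h
  push_cast at h1
  obtain ⟨h2, h3⟩ := key a b h1
  exact ⟨(ZMod.intCast_zmod_eq_zero_iff_dvd a 23).1 h2, (ZMod.intCast_zmod_eq_zero_iff_dvd b 23).1 h3⟩

theorem prime23 : Prime (23 : ℤ) := by
  rw [Int.prime_iff_natAbs_prime]; norm_num

theorem prime_int_cases (p : ℤ) (hp : Prime p) (q : ℤ) (hq : Prime q) (h : p ∣ q) : q ∣ p :=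
  (hp.irreducible.associated_of_dvd hq.irreducible h).symm.dvd

theorem step_fin (m c Q : ℤ) (h : m * (c ^ 2 - (m + Q) ^ 2) = Q ^ 3) (hm : Even m)
    (hQ : Q ≠ 0) (hcop : ∀ p : ℤ, Prime p → p ∣ m → p ∣ Q → p ∣ c → False) :
    ∃ A B k j : ℤ, Q = A * B ∧ IsCoprime k j ∧ Odd k ∧ Odd j ∧ Even B ∧ A = j * k ∧
      k ^ 3 - j ^ 3 = 2 * B * (j * k + B ^ 2) := by
  have odd3 : Odd 3 := by decide
  have inj3 : Function.Injective (fun x : ℤ => x ^ 3) := (Odd.strictMono_pow odd3).injective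
  have hm0 : m ≠ 0 := by
    rintro rfl
    apply hQ
    have : Q ^ 3 = 0 := by linarith
    exact pow_eq_zero_iff (by norm_num) |>.1 this
  have hco : IsCoprime m (c ^ 2 - (m + Q) ^ 2) := by
    apply isCoprime_of_prime_dvd (fun h => hm0 h.1)
    intro p hp h1 h2
    have h3 : p ∣ Q := hp.dvd_of_dvd_pow (h ▸ h1.mul_right _)
    have h4 : p ∣ c ^ 2 := by
      have : c ^ 2 = (c ^ 2 - (m + Q) ^ 2) + (m + Q) * (m + Q) := by ring
      rw [this]
      exact dvd_add h2 ((dvd_add h1 h3).mul_right _)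
    exact hcop p hp h1 h3 (hp.dvd_of_dvd_pow h4)
  obtain ⟨⟨B, hB⟩, ⟨A, hA⟩⟩ := Int.eq_pow_of_mul_eq_pow_odd hco odd3 h
  have hQAB : Q = A * B := by
    apply inj3
    show Q ^ 3 = (A * B) ^ 3
    rw [← h, hA, hB]; ring
  have hAB : IsCoprime B A := by
    rw [hA, hB] at hco
    exact (IsCoprime.pow_iff (by norm_num) (by norm_num)).1 hco
  have hBe : Even B := by
    rw [hB] at hm
    exact (Int.even_pow.1 hm).1
  have hAo : Odd A := by
    rw [← Int.not_even_iff_odd]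
    intro hAe
    exact Int.prime_two.not_isUnit (hAB.isUnit_of_dvd' hBe.two_dvd hAe.two_dvd)
  have hprod : (c - B * (A + B ^ 2)) * (c + B * (A + B ^ 2)) = A ^ 3 := by
    rw [← hA, hB, hQAB]; ring
  have hA0 : A ≠ 0 := by rintro rfl; simp at hAo
  have hco2 : IsCoprime (c - B * (A + B ^ 2)) (c + B * (A + B ^ 2)) := by
    apply isCoprime_of_prime_dvd
    · rintro ⟨h1, -⟩
      rw [h1, zero_mul] at hprod
      exact hA0 (pow_eq_zero_iff (by norm_num) |>.1 hprod.symm)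
    intro p hp h1 h2
    have h3 : p ∣ A := hp.dvd_of_dvd_pow (hprod ▸ h1.mul_right _)
    have h4 : p ∣ 2 * (B * (A + B ^ 2)) := by
      have := dvd_sub h2 h1
      rwa [show (c + B * (A + B ^ 2)) - (c - B * (A + B ^ 2)) = 2 * (B * (A + B ^ 2)) by ring] at this
    have h5 : ¬ p ∣ B := fun h5 => hp.not_isUnit (hAB.isUnit_of_dvd' h5 h3)
    rcases hp.dvd_or_dvd h4 with h6 | h6
    · have : (2 : ℤ) ∣ A := (prime_int_cases p hp 2 Int.prime_two h6).trans h3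
      exact (Int.not_even_iff_odd.2 hAo) (even_iff_two_dvd.2 this)
    · rcases hp.dvd_or_dvd h6 with h7 | h7
      · exact h5 h7
      · exact h5 (hp.dvd_of_dvd_pow ((dvd_add_right h3).1 h7))
  obtain ⟨⟨j, hj⟩, ⟨k, hk⟩⟩ := Int.eq_pow_of_mul_eq_pow_odd hco2 odd3 hprod
  have hAjk : A = j * k := by
    apply inj3
    show A ^ 3 = (j * k) ^ 3
    rw [← hprod, hj, hk]; ring
  rw [hAjk] at hAo
  obtain ⟨hjo, hko⟩ := Int.odd_mul.1 hAo
  refine ⟨A, B, k, j, hQAB, ?_, hko, hjo, hBe, hAjk, ?_⟩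
  · rw [hj, hk] at hco2
    exact ((IsCoprime.pow_iff (by norm_num) (by norm_num)).1 hco2).symm
  · rw [← hk, ← hj, ← hAjk]; ring

theorem step1 (k j B : ℤ) (hkj : IsCoprime k j) (hk : Odd k) (hj : Odd j) (hB : Even B) (hB0 : B ≠ 0)
    (h : k ^ 3 - j ^ 3 = 2 * B * (j * k + B ^ 2)) :
    ∃ g U e κ w : ℤ, B = 2 * g * U ∧ Odd U ∧ IsCoprime e U ∧ 3 * e - U = 4 * g ^ 2 * κ ∧ κ ∣ 23 ∧
      27 * κ * w ^ 2 + 4 * κ * g ^ 2 * (3 * U + 4 * κ * g ^ 2) ^ 2 = 23 * U ^ 3 := by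
  obtain ⟨U₀, rfl⟩ := hB.two_dvd
  have hU0 : U₀ ≠ 0 := by rintro rfl; simp at hB0
  obtain ⟨δ, hδ⟩ := (hk.sub_odd hj).two_dvd
  have hk' : k = j + 2 * δ := by linarith
  have hodd1 : Odd (4 * δ ^ 2 + 3 * (j * k)) := by
    have := (hj.mul hk)
    obtain ⟨t, ht⟩ := this
    exact ⟨2 * δ ^ 2 + 3 * t + 1, by rw [ht]; ring⟩
  have h2 : δ * (4 * δ ^ 2 + 3 * (j * k)) = 2 * (U₀ * (j * k + 4 * U₀ ^ 2)) := by
    rw [hk'] at h ⊢; linarith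
  have hδe : Even δ := by
    have : Even (δ * (4 * δ ^ 2 + 3 * (j * k))) := by rw [h2]; exact even_two_mul _
    rcases Int.even_mul.1 this with h | h
    · exact h
    · exact absurd h (Int.not_even_iff_odd.2 hodd1)
  obtain ⟨e₀, rfl⟩ := hδe.two_dvd
  have h3 : j * k * (3 * e₀ - U₀) = 4 * (U₀ ^ 3 - 4 * e₀ ^ 3) := by
    rw [hk'] at h2 ⊢; linarith
  -- divide out the gcd
  have hg0 : (0 : ℕ) < Int.gcd e₀ U₀ := Int.gcd_pos_of_ne_zero_right _ hU0
  obtain ⟨g, e, U, hg, hcop, he, hU⟩ : ∃ g e U : ℤ, g ≠ 0 ∧ IsCoprime e U ∧ e₀ = g * e ∧ U₀ = g * U := by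
    obtain ⟨e, U, hc, he, hU⟩ := Int.exists_gcd_one hg0
    exact ⟨Int.gcd e₀ U₀, e, U, by exact_mod_cast hg0.ne', Int.isCoprime_iff_gcd_eq_one.2 hc,
      by rw [mul_comm]; exact he, by rw [mul_comm]; exact hU⟩
  subst he hU
  have h4 : j * k * (3 * e - U) = 4 * g ^ 2 * (U ^ 3 - 4 * e ^ 3) := by
    apply mul_left_cancel₀ hg; linear_combination h3
  -- `g` and 4 are coprime to `j * k`
  have hjk : Odd (j * k) := hj.mul hk
  have c2 : IsCoprime (2 : ℤ) (j * k) := by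
    obtain ⟨t, ht⟩ := hjk
    exact ⟨-t, 1, by rw [ht]; ring⟩
  have cg : IsCoprime g (j * k) := by
    apply isCoprime_of_prime_dvd (fun h => hg h.1)
    intro p hp h5 h6
    have h7 : p ∣ k - j := by
      rw [hk']; exact ⟨4 * e * (g / p), by obtain ⟨t, rfl⟩ := h5; rw [Int.mul_ediv_cancel_left _ hp.ne_zero]; ring⟩
    rcases hp.dvd_or_dvd h6 with h8 | h8
    · exact hp.not_isUnit (hkj.isUnit_of_dvd' (by simpa using dvd_add h7 h8) h8)
    · exact hp.not_isUnit (hkj.isUnit_of_dvd' h8 (by simpa using dvd_sub h8 h7))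
  have c4 : IsCoprime (4 * g ^ 2) (j * k) := by
    have : (4 : ℤ) * g ^ 2 = 2 ^ 2 * g ^ 2 := by norm_num
    rw [this]
    exact (c2.pow_left).mul_left (cg.pow_left)
  obtain ⟨κ, hκ⟩ : 4 * g ^ 2 ∣ 3 * e - U := c4.dvd_of_dvd_mul_left (h4 ▸ dvd_mul_right _ _)
  have h5 : j * k * κ = U ^ 3 - 4 * e ^ 3 := by
    have : (4 * g ^ 2) ≠ 0 := by positivity
    apply mul_left_cancel₀ this
    rw [← h4, hκ]; ring
  have hUe : U = 3 * e - 4 * g ^ 2 * κ := by linarith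
  have hUo : Odd U := by
    rw [← Int.not_even_iff_odd]
    intro hUev
    have : Even (3 * e) := by
      rw [show 3 * e = U + 2 * (2 * g ^ 2 * κ) by linarith]
      exact hUev.add (even_two_mul _)
    have h7 : Even e := by
      rcases Int.even_mul.1 this with h | h
      · exact absurd h (by decide)
      · exact h
    exact Int.prime_two.not_isUnit (hcop.isUnit_of_dvd' h7.two_dvd hUev.two_dvd)
  have hκ23 : κ ∣ 23 := by
    have hce : IsCoprime κ e := by
      have h8 : IsCoprime (U ^ 3) e := (hcop.symm).pow_left
      have h9 : IsCoprime (j * k * κ) e := by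
        rw [h5, show U ^ 3 - 4 * e ^ 3 = U ^ 3 + e * (-4 * e ^ 2) by ring]
        exact IsCoprime.add_mul_left_left h8 _
      exact h9.of_mul_left_right
    have h10 : κ ∣ 23 * e ^ 3 := by
      refine ⟨j * k - (-108 * e ^ 2 * g ^ 2 + 144 * e * g ^ 4 * κ - 64 * g ^ 6 * κ ^ 2), ?_⟩
      rw [hUe] at h5
      linear_combination -h5
    exact (hce.pow_right).dvd_of_dvd_mul_right h10
  refine ⟨g, U, e, κ, j + 2 * (g * e), by ring, hUo, hcop, hκ, hκ23, ?_⟩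
  have h11 : κ * (j + 2 * (g * e)) ^ 2 = U ^ 3 - 4 * e ^ 3 + 4 * κ * g ^ 2 * e ^ 2 := by
    rw [← h5, hk']; ring
  rw [show 27 * κ * (j + 2 * (g * e)) ^ 2 = 27 * (κ * (j + 2 * (g * e)) ^ 2) by ring, h11, hUe]
  ring

theorem step2 (g U e κ w : ℤ) (hcop : IsCoprime e U) (h3 : 3 * e - U = 4 * g ^ 2 * κ)
    (hκ : κ ∣ 23)
    (h : 27 * κ * w ^ 2 + 4 * κ * g ^ 2 * (3 * U + 4 * κ * g ^ 2) ^ 2 = 23 * U ^ 3) :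
    ∃ T f : ℤ, (T = U ∨ T = -U) ∧ IsCoprime f T ∧ 3 * f = T + 92 * g ^ 2 ∧
      27 * w ^ 2 + 4 * g ^ 2 * (3 * T + 92 * g ^ 2) ^ 2 = T ^ 3 := by
  have hcases : κ = 1 ∨ κ = -1 ∨ κ = 23 ∨ κ = -23 := by
    have h1 : κ.natAbs ∣ 23 := by
      have := Int.natAbs_dvd_natAbs.2 hκ
      simpa using this
    rcases (Nat.dvd_prime (by norm_num : Nat.Prime 23)).1 h1 with h | h <;> omega
  have bad : ∀ s : ℤ, (s = 1 ∨ s = -1) → κ = s → False := by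
    intro s hs hκs
    subst hκs
    have hs2 : κ ^ 2 = 1 := by rcases hs with h | h <;> rw [h] <;> norm_num
    have e1 : 27 * w ^ 2 + 4 * (g * (3 * U + 4 * κ * g ^ 2)) ^ 2 = 23 * (κ * U ^ 3) := by
      linear_combination κ * h - (27 * w ^ 2 + 4 * (g * (3 * U + 4 * κ * g ^ 2)) ^ 2) * hs2
    obtain ⟨⟨w', hw⟩, ⟨z', hz⟩⟩ := mod23 w (g * (3 * U + 4 * κ * g ^ 2)) (e1 ▸ dvd_mul_right _ _)
    have hU3 : (23 : ℤ) ∣ U ^ 3 := by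
      refine ⟨κ * (27 * w' ^ 2 + 4 * z' ^ 2), ?_⟩
      rw [hz, hw] at e1
      have e2 : κ * U ^ 3 = 23 * (27 * w' ^ 2 + 4 * z' ^ 2) := by linarith
      linear_combination κ * e2 - U ^ 3 * hs2
    have hU : (23 : ℤ) ∣ U := prime23.dvd_of_dvd_pow hU3
    have hg : (23 : ℤ) ∣ g := by
      rcases prime23.dvd_or_dvd (Dvd.intro _ hz.symm) with h6 | h6
      · exact h6
      · have h7 : (23 : ℤ) ∣ 4 * κ * g ^ 2 := (dvd_add_right (hU.mul_left 3)).1 h6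
        rcases prime23.dvd_or_dvd h7 with h8 | h8
        · rcases hs with h | h <;> rw [h] at h8 <;> norm_num at h8
        · exact prime23.dvd_of_dvd_pow h8
    have he : (23 : ℤ) ∣ 3 * e := by
      rw [show 3 * e = U + g * (4 * g * κ) by linear_combination h3]
      exact dvd_add hU (hg.mul_right _)
    have he' : (23 : ℤ) ∣ e := by
      rcases prime23.dvd_or_dvd he with h | h
      · norm_num at h
      · exact h
    exact prime23.not_isUnit (hcop.isUnit_of_dvd' he' hU)
  rcases hcases with h1 | h1 | h1 | h1
  · exact (bad 1 (by simp) h1).elim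
  · exact (bad (-1) (by simp) h1).elim
  · subst h1
    exact ⟨U, e, Or.inl rfl, hcop, by linarith, by linarith⟩
  · subst h1
    refine ⟨-U, -e, Or.inr rfl, hcop.neg_neg, by linarith, by linarith⟩

theorem step3 (g T f w : ℤ) (hT : Odd T) (hcop : IsCoprime f T) (h3 : 3 * f = T + 92 * g ^ 2)
    (h : 27 * w ^ 2 + 4 * g ^ 2 * (3 * T + 92 * g ^ 2) ^ 2 = T ^ 3) :
    ∃ m c Q : ℤ, m * (c ^ 2 - (m + Q) ^ 2) = Q ^ 3 ∧ Even m ∧ (Q = 2 * g ∨ Q = -(2 * g)) ∧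
      ∀ p : ℤ, Prime p → p ∣ m → p ∣ Q → p ∣ c → False := by
  have hT0 : T ≠ 0 := by rintro rfl; simp at hT
  have n2 : ∀ p : ℤ, Prime p → p ∣ T → ¬ p ∣ 2 := by
    intro p hp h1 h2
    exact (Int.not_even_iff_odd.2 hT)
      (even_iff_two_dvd.2 ((prime_int_cases p hp 2 Int.prime_two h2).trans h1))
  have ng : ∀ p : ℤ, Prime p → p ∣ T → p ∣ g → p ∣ 3 := by
    intro p hp h1 h2
    have h4 : p ∣ 3 * f := by
      rw [h3, show 92 * g ^ 2 = g * (92 * g) by ring]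
      exact dvd_add h1 (h2.mul_right _)
    rcases hp.dvd_or_dvd h4 with h5 | h5
    · exact h5
    · exact (hp.not_isUnit (hcop.isUnit_of_dvd' h5 h1)).elim
  have n23 : ¬ (23 : ℤ) ∣ T := by
    rintro ⟨t, ht⟩
    have hTd : (23 : ℤ) ∣ T := ⟨t, ht⟩
    have e0 : 27 * w ^ 2 + 4 * (g * (3 * T + 92 * g ^ 2)) ^ 2 = 23 * (23 ^ 2 * t ^ 3) := by
      rw [ht] at h ⊢; linear_combination h
    obtain ⟨⟨w', hw⟩, -⟩ := mod23 _ _ (e0 ▸ dvd_mul_right _ _)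
    have e1 : 27 * w' ^ 2 + 4 * (g * (3 * t + 4 * g ^ 2)) ^ 2 = 23 * t ^ 3 := by
      rw [hw, ht] at e0
      have : (529 : ℤ) ≠ 0 := by norm_num
      apply mul_left_cancel₀ this
      linear_combination e0
    obtain ⟨⟨w2, hw2⟩, ⟨z2, hz2⟩⟩ := mod23 _ _ (e1 ▸ dvd_mul_right _ _)
    have ht3 : (23 : ℤ) ∣ t ^ 3 := by
      rw [hw2, hz2] at e1
      exact ⟨27 * w2 ^ 2 + 4 * z2 ^ 2, by linarith⟩
    have ht' : (23 : ℤ) ∣ t := prime23.dvd_of_dvd_pow ht3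
    have hg : (23 : ℤ) ∣ g := by
      rcases prime23.dvd_or_dvd (Dvd.intro _ hz2.symm) with h6 | h6
      · exact h6
      · have h7 : (23 : ℤ) ∣ 4 * g ^ 2 := (dvd_add_right (ht'.mul_left 3)).1 h6
        rcases prime23.dvd_or_dvd h7 with h8 | h8
        · norm_num at h8
        · exact prime23.dvd_of_dvd_pow h8
    have := ng 23 prime23 hTd hg
    norm_num at this
  have n92 : ∀ p : ℤ, Prime p → p ∣ T → p ∣ 92 * g ^ 2 → p ∣ g := by
    intro p hp h1 h2
    rw [show (92 : ℤ) * g ^ 2 = 2 * (2 * (23 * g ^ 2)) by ring] at h2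
    have h4 := (hp.dvd_or_dvd ((hp.dvd_or_dvd h2).resolve_left (n2 p hp h1))).resolve_left (n2 p hp h1)
    rcases hp.dvd_or_dvd h4 with h5 | h5
    · exact (n23 ((prime_int_cases p hp 23 prime23 h5).trans h1)).elim
    · exact hp.dvd_of_dvd_pow h5
  by_cases h3g : (3 : ℤ) ∣ g
  · obtain ⟨s, rfl⟩ := h3g
    obtain ⟨R, rfl⟩ : (3 : ℤ) ∣ T := ⟨f - 276 * s ^ 2, by linarith⟩
    have hf : f = R + 276 * s ^ 2 := by linarith
    have hR3 : ¬ (3 : ℤ) ∣ R := by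
      rintro ⟨r, rfl⟩
      have h1 : (3 : ℤ) ∣ f := ⟨r + 92 * s ^ 2, by linarith⟩
      exact Int.prime_three.not_isUnit (hcop.isUnit_of_dvd' h1 (dvd_mul_right _ _))
    have e1 : w ^ 2 + 27 * (2 * s * (R + 92 * s ^ 2)) ^ 2 = R ^ 3 := by
      have : (27 : ℤ) ≠ 0 := by norm_num
      apply mul_left_cancel₀ this
      linear_combination h
    have hR0 : R ≠ 0 := by rintro rfl; simp at hT0
    have hRo : Odd R := (Int.odd_mul.1 hT).2
    have ns : ∀ p : ℤ, Prime p → p ∣ R → ¬ p ∣ s := by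
      intro p hp h1 h2
      have := ng p hp (h1.mul_left 3) (h2.mul_left 3)
      exact hR3 ((prime_int_cases p hp 3 Int.prime_three this).trans h1)
    have hcR : IsCoprime R (2 * w) := by
      apply isCoprime_of_prime_dvd (fun h => hR0 h.1)
      intro p hp h1 h2
      have hpT : p ∣ 3 * R := h1.mul_left 3
      have h4 := (hp.dvd_or_dvd h2).resolve_left (n2 p hp hpT)
      have hp3 : ¬ p ∣ 3 := fun h => hR3 ((prime_int_cases p hp 3 Int.prime_three h).trans h1)
      have h5 : p ∣ 3 * (3 * (3 * (2 * s * (R + 92 * s ^ 2)) ^ 2)) := by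
        rw [show 3 * (3 * (3 * (2 * s * (R + 92 * s ^ 2)) ^ 2)) = R * R ^ 2 - w * w by
          linear_combination e1]
        exact dvd_sub (h1.mul_right _) (h4.mul_right _)
      have h6 := hp.dvd_of_dvd_pow ((hp.dvd_or_dvd ((hp.dvd_or_dvd ((hp.dvd_or_dvd
        h5).resolve_left hp3)).resolve_left hp3)).resolve_left hp3)
      rcases hp.dvd_or_dvd h6 with h7 | h7
      · rcases hp.dvd_or_dvd h7 with h8 | h8
        · exact n2 p hp hpT h8
        · exact ns p hp h1 h8
      · have h8 : p ∣ 92 * s ^ 2 := (dvd_add_right h1).1 h7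
        have h9 : p ∣ 3 * s := n92 p hp hpT (by
          rw [show 92 * (3 * s) ^ 2 = 9 * (92 * s ^ 2) by ring]; exact h8.mul_left _)
        exact ns p hp h1 ((hp.dvd_or_dvd h9).resolve_left hp3)
    obtain ⟨c, d, hX, hY, hTT⟩ := cube_lemma w (2 * s * (R + 92 * s ^ 2)) R e1 hcR
    have hd : Even d := by
      by_contra hdo
      rw [Int.not_even_iff_odd] at hdo
      have hce : Even c := by
        by_contra hco
        rw [Int.not_even_iff_odd] at hco
        have : Even R := by
          rw [hTT]; exact (hco.pow).add_odd ((by decide : Odd (3 : ℤ)).mul hdo.pow)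
        exact (Int.not_even_iff_odd.2 hRo) this
      have h1 : Odd (d * (c ^ 2 - d ^ 2)) :=
        hdo.mul ((hce.pow_of_ne_zero two_ne_zero).sub_odd hdo.pow)
      rw [← hY, mul_assoc] at h1
      exact (Int.not_even_iff_odd.2 h1) (even_two_mul _)
    refine ⟨d - 2 * s, c, 6 * s, ?_, hd.sub (even_two_mul _), Or.inl (by ring), ?_⟩
    · rw [hTT] at hY
      linear_combination -hY
    · intro p hp h1 h2 h4
      have hw : p ∣ 2 * w := by
        rw [hX, show 2 * (c ^ 3 - 9 * c * d ^ 2) = c * (2 * (c ^ 2 - 9 * d ^ 2)) by ring]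
        exact h4.mul_right _
      have hR : p ∣ R := by
        have h5 : p ∣ 3 * d := by
          rw [show (3 : ℤ) * d = 3 * (d - 2 * s) + 6 * s by ring]
          exact dvd_add (h1.mul_left _) h2
        rw [hTT, show c ^ 2 + 3 * d ^ 2 = c * c + 3 * d * d by ring]
        exact dvd_add (h4.mul_right _) (h5.mul_right _)
      exact hp.not_isUnit (hcR.isUnit_of_dvd' hR hw)
  · have ng' : ∀ p : ℤ, Prime p → p ∣ T → ¬ p ∣ g := by
      intro p hp h1 h2
      exact h3g ((prime_int_cases p hp 3 Int.prime_three (ng p hp h1 h2)).trans h2)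
    have e1 : (2 * g * (3 * T + 92 * g ^ 2)) ^ 2 + 27 * w ^ 2 = T ^ 3 := by
      linear_combination h
    have hcT : IsCoprime T (2 * (2 * g * (3 * T + 92 * g ^ 2))) := by
      apply isCoprime_of_prime_dvd (fun h => hT0 h.1)
      intro p hp h1 h2
      have h4 := (hp.dvd_or_dvd h2).resolve_left (n2 p hp h1)
      rcases hp.dvd_or_dvd h4 with h5 | h5
      · exact ng' p hp h1 ((hp.dvd_or_dvd h5).resolve_left (n2 p hp h1))
      · exact ng' p hp h1 (n92 p hp h1 ((dvd_add_right (h1.mul_left 3)).1 h5))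
    obtain ⟨c, d, hX, hY, hTT⟩ := cube_lemma _ w T e1 hcT
    have hce : Even c := by
      by_contra hco
      rw [Int.not_even_iff_odd] at hco
      have hde : Even d := by
        by_contra hdo
        rw [Int.not_even_iff_odd] at hdo
        have : Even T := by
          rw [hTT]; exact (hco.pow).add_odd ((by decide : Odd (3 : ℤ)).mul hdo.pow)
        exact (Int.not_even_iff_odd.2 hT) this
      have h1 : Odd (c * (c ^ 2 - 9 * d ^ 2)) :=
        hco.mul (hco.pow.sub_even ((hde.pow_of_ne_zero two_ne_zero).mul_left _))
      rw [show c * (c ^ 2 - 9 * d ^ 2) = 2 * (g * (3 * T + 92 * g ^ 2)) by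
        linear_combination -hX] at h1
      exact (Int.not_even_iff_odd.2 h1) (even_two_mul _)
    obtain ⟨μ, hμ⟩ : (3 : ℤ) ∣ c + 2 * g := by
      apply Int.prime_three.dvd_of_dvd_pow (n := 3)
      exact ⟨3 * c * d ^ 2 + 2 * g * T + 64 * g ^ 3 + 2 * c ^ 2 * g + 4 * c * g ^ 2, by
        linear_combination -hX⟩
    have hc' : c = 3 * μ - 2 * g := by linarith
    refine ⟨μ, d, -(2 * g), ?_, ?_, Or.inr rfl, ?_⟩
    · have : (27 : ℤ) ≠ 0 := by norm_num
      apply mul_left_cancel₀ this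
      rw [hTT, hc'] at hX
      linear_combination hX
    · have : Even (3 * μ) := by rw [← hμ]; exact hce.add (even_two_mul _)
      rcases Int.even_mul.1 this with h | h
      · exact absurd h (by decide)
      · exact h
    · intro p hp h1 h2 h4
      have h2' : p ∣ 2 * g := (dvd_neg).1 h2
      have h5 : p ∣ c := by
        rw [hc']; exact dvd_sub (h1.mul_left _) h2'
      have h6 : p ∣ T := by
        rw [hTT, show c ^ 2 + 3 * d ^ 2 = c * c + d * (3 * d) by ring]
        exact dvd_add (h5.mul_right _) (h4.mul_right _)
      exact hp.not_isUnit (hcT.isUnit_of_dvd' h6 ((h2'.mul_right _).mul_left _))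

theorem descent (n : ℕ) : ∀ k j B : ℤ, B.natAbs = n → IsCoprime k j → Odd k → Odd j → Even B →
    B ≠ 0 → k ^ 3 - j ^ 3 = 2 * B * (j * k + B ^ 2) → False := by
  induction n using Nat.strong_induction_on with
  | _ n ih =>
  intro k j B hn hkj hk hj hB hB0 h
  obtain ⟨g, U, e, κ, w, hBg, hU, heU, h3, hκ, h4⟩ := step1 k j B hkj hk hj hB hB0 h
  obtain ⟨T, f, hTU, hfT, h5, h6⟩ := step2 g U e κ w heU h3 hκ h4
  have hT : Odd T := by rcases hTU with rfl | rfl; exacts [hU, hU.neg]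
  obtain ⟨m, c, Q, h7, hm, hQ, hc⟩ := step3 g T f w hT hfT h5 h6
  have hg0 : g ≠ 0 := by rintro rfl; simp at hBg; exact hB0 hBg
  have hU0 : U ≠ 0 := by rintro rfl; simp at hU
  have hQ0 : Q ≠ 0 := by rcases hQ with rfl | rfl <;> simpa using hg0
  obtain ⟨A, B', k', j', hQA, hkj', hk', hj', hB', hA, h8⟩ := step_fin m c Q h7 hm hQ0 hc
  have hB'0 : B' ≠ 0 := by rintro rfl; simp at hQA; exact hQ0 hQA
  have hA0 : A ≠ 0 := by rintro rfl; simp at hQA; exact hQ0 hQA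
  have hA1 : A.natAbs ≠ 1 := by
    intro hA1
    obtain ⟨b, rfl⟩ := hB'.two_dvd
    have hu : IsUnit (j' * k') := by rw [← hA]; exact Int.isUnit_iff_natAbs_eq.2 hA1
    rcases Int.isUnit_iff.1 (isUnit_of_mul_isUnit_left hu) with rfl | rfl <;>
    rcases Int.isUnit_iff.1 (isUnit_of_mul_isUnit_right hu) with rfl | rfl
    · have : b * (1 + 4 * b ^ 2) = 0 := by linarith
      rcases mul_eq_zero.1 this with h | h
      · simp [h] at hB'0
      · nlinarith [sq_nonneg b]
    · have : 2 * (b * (4 * b ^ 2 - 1)) = -1 := by linarith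
      omega
    · have : 2 * (b * (4 * b ^ 2 - 1)) = 1 := by linarith
      omega
    · have : b * (1 + 4 * b ^ 2) = 0 := by linarith
      rcases mul_eq_zero.1 this with h | h
      · simp [h] at hB'0
      · nlinarith [sq_nonneg b]
  refine ih B'.natAbs ?_ k' j' B' rfl hkj' hk' hj' hB' hB'0 h8
  have e1 : n = A.natAbs * B'.natAbs * U.natAbs := by
    have : B.natAbs = Q.natAbs * U.natAbs := by
      rcases hQ with rfl | rfl
      · rw [hBg, Int.natAbs_mul]
      · rw [hBg, Int.natAbs_mul, Int.natAbs_neg]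
    rw [← hn, this, hQA, Int.natAbs_mul]
  have a1 : 2 ≤ A.natAbs := by
    have := Int.natAbs_pos.2 hA0
    omega
  have a2 : 1 ≤ U.natAbs := Int.natAbs_pos.2 hU0
  have a3 : 1 ≤ B'.natAbs := Int.natAbs_pos.2 hB'0
  rw [e1]
  calc B'.natAbs < 2 * B'.natAbs * 1 := by omega
    _ ≤ A.natAbs * B'.natAbs * U.natAbs := by gcongr

theorem int_case (a b Y : ℤ) (hab : IsCoprime a b) (hb : b ≠ 0)
    (h : Y ^ 2 = (a * (a ^ 2 - b ^ 2)) ^ 2 - b ^ 6) : False := by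
  have odd3 : Odd 3 := by decide
  have inj3 : Function.Injective (fun x : ℤ => x ^ 3) := (Odd.strictMono_pow odd3).injective
  rcases Int.even_or_odd b with hbe | hbo
  swap
  · have hA : Even (a * (a ^ 2 - b ^ 2)) := by
      rcases Int.even_or_odd a with ha | ha
      · exact ha.mul_right _
      · exact (ha.pow.sub_odd hbo.pow).mul_left _
    obtain ⟨t, ht⟩ := hA.two_dvd
    have hb3 : Odd (b ^ 3) := hbo.pow
    obtain ⟨r, hr⟩ := hb3
    rw [ht, show b ^ 6 = (b ^ 3) ^ 2 by ring, hr] at h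
    rcases Int.even_or_odd' Y with ⟨y, hy | hy⟩ <;> rw [hy] at h
    · have : 4 * (y ^ 2 - t ^ 2 + r ^ 2 + r) = -1 := by linarith
      omega
    · have : 4 * (y ^ 2 + y - t ^ 2 + r ^ 2 + r) = -2 := by linarith
      omega
  obtain ⟨β, rfl⟩ := hbe.two_dvd
  have hβ : β ≠ 0 := by rintro rfl; simp at hb
  have hao : Odd a := by
    rw [← Int.not_even_iff_odd]
    intro ha
    exact Int.prime_two.not_isUnit (hab.isUnit_of_dvd' ha.two_dvd (dvd_mul_right _ _))
  have hA : Odd (a * (a ^ 2 - (2 * β) ^ 2)) :=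
    hao.mul (hao.pow.sub_even ((even_two_mul β).pow_of_ne_zero two_ne_zero))
  have hY : Odd Y := by
    have : Odd (Y ^ 2) := by
      rw [h]; exact hA.pow.sub_even ((even_two_mul β).pow_of_ne_zero (by norm_num))
    exact (Int.odd_pow.1 this).resolve_right two_ne_zero
  -- symmetric formulation
  have main : ∀ m n : ℤ, m + n = a * (a ^ 2 - (2 * β) ^ 2) → m * n = 16 * β ^ 6 → Even n → False := by
    intro m n hs hp hn
    have hm : Odd m := by
      rw [← hs] at hA
      exact (Int.odd_add.1 hA).2 hn
    have c2 : IsCoprime (2 : ℤ) m := by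
      obtain ⟨t, ht⟩ := hm
      exact ⟨-t, 1, by rw [ht]; ring⟩
    have c16 : IsCoprime (16 : ℤ) m := by
      rw [show (16 : ℤ) = 2 ^ 4 by norm_num]; exact c2.pow_left
    obtain ⟨n', rfl⟩ : (16 : ℤ) ∣ n := c16.dvd_of_dvd_mul_left (hp ▸ dvd_mul_right _ _)
    have hp' : m * n' = (β ^ 2) ^ 3 := by
      have : (16 : ℤ) ≠ 0 := by norm_num
      apply mul_left_cancel₀ this
      linear_combination hp
    have hm0 : m ≠ 0 := by rintro rfl; simp at hm
    have hco : IsCoprime m n' := by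
      apply isCoprime_of_prime_dvd (fun h => hm0 h.1)
      intro p hpp h1 h2
      have h3 : p ∣ β := hpp.dvd_of_dvd_pow (hpp.dvd_of_dvd_pow (hp' ▸ h1.mul_right _))
      have h4 : p ∣ a ^ 3 := by
        rw [show a ^ 3 = m + n' * 16 + β * (4 * a * β) by linear_combination -hs]
        exact dvd_add (dvd_add h1 (h2.mul_right _)) (h3.mul_right _)
      exact hpp.not_isUnit (hab.isUnit_of_dvd' (hpp.dvd_of_dvd_pow h4) (h3.mul_left _))
    obtain ⟨⟨V, hV⟩, ⟨U, hU⟩⟩ := Int.eq_pow_of_mul_eq_pow_odd hco odd3 hp'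
    have hVU : V * U = β ^ 2 := by
      apply inj3
      show (V * U) ^ 3 = (β ^ 2) ^ 3
      rw [← hp', hV, hU]; ring
    have hU0 : U ≠ 0 := by
      rintro rfl
      rw [mul_zero] at hVU
      exact hβ (pow_eq_zero_iff two_ne_zero |>.1 hVU.symm)
    have hVo : Odd V := by
      rw [hV] at hm
      exact (Int.odd_pow.1 hm).resolve_right (by norm_num)
    have haV : IsCoprime a V := by
      have h1 : IsCoprime a (β ^ 2) := (hab.of_mul_right_right).pow_right
      rw [← hVU] at h1
      exact h1.of_mul_right_left
    apply descent _ a V (2 * U) rfl haV hao hVo (even_two_mul _) (by simpa using hU0)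
    rw [hV, hU] at hs
    linear_combination -hs - 4 * a * hVU
  obtain ⟨m, hm⟩ := (hA.sub_odd hY).two_dvd
  have hn : a * (a ^ 2 - (2 * β) ^ 2) = m + (m + Y) := by linarith
  have hprod : m * (m + Y) = 16 * β ^ 6 := by
    rw [hn] at h; linarith
  rcases Int.even_or_odd m with he | ho
  · exact main (m + Y) m (by rw [hn]; ring) (by rw [mul_comm]; exact hprod) he
  · exact main m (m + Y) hn.symm hprod (ho.add_odd hY)

theorem stmt_13 : ¬ ∃ x y : ℚ, y ^ 2 = x ^ 6 - 2 * x ^ 4 + x ^ 2 - 1 := by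
  rintro ⟨x, y, h⟩
  have hd : (x.den : ℚ) ≠ 0 := by exact_mod_cast x.den_nz
  have hx : x * x.den = x.num := Rat.mul_den_eq_num x
  have h1 : (y * x.den ^ 3) ^ 2 =
      (((x.num * (x.num ^ 2 - (x.den : ℤ) ^ 2)) ^ 2 - (x.den : ℤ) ^ 6 : ℤ) : ℚ) := by
    push_cast
    rw [← hx]
    linear_combination (x.den : ℚ) ^ 6 * h
  have h2 : ∃ Y : ℤ, y * x.den ^ 3 = Y := by
    have hi : IsIntegral ℤ (y * x.den ^ 3) := by
      apply IsIntegral.of_pow (n := 2) (by norm_num)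
      rw [h1]
      exact isIntegral_algebraMap
    obtain ⟨Y, hY⟩ := IsIntegrallyClosed.isIntegral_iff.1 hi
    exact ⟨Y, by rw [← hY]; simp⟩
  obtain ⟨Y, hY⟩ := h2
  rw [hY] at h1
  refine int_case x.num x.den Y ?_ (by exact_mod_cast x.den_nz) (by exact_mod_cast h1)
  exact Int.isCoprime_iff_gcd_eq_one.2 (by simpa [Int.gcd] using x.reduced)
end
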